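/- Suppose ζ = q₀q₁⋯q_{m−1} is a primitive d-th root of unity in k. Then Z_gr(E(Γ_q)) ≅ (k[x,y,w]/⟨w^{2m} − ε_d x y⟩)_{x*} if m is odd, char k ≠ 2, and d ≡ 2 (mod 4); and Z_gr(E(Γ_q)) ≅ (k[x,y,w]/⟨w^{m} − ε_d x y⟩)_{x*} in all other cases. Here ε_d ∈ k^* is given by: ε_d = (−1)^{md/2} Π_{l=1}^{m−1} Π_{k=1}^{ld} (q_k q_{k+1}⋯q_{k+d−1})^{−1} if m is even or char k = 2; ε_d = Π_{l=1}^{m−1} Π_{k=1}^{ld} (q_k⋯q_{k+d−1})^{−1} if m is odd, char k ≠ 2, and d ≡ 0 (mod 4); ε_d = Π_{l=1}^{2m−1} Π_{k=1}^{ld/2} (q_k⋯q_{k+d/2−1})^{−1} if m is odd, char k ≠ 2, and d ≡ 2 (mod 4); ε_d = Π_{l=1}^{m−1} Π_{k=1}^{2ld} (q_k⋯q_{k+2d−1})^{−1} if m is odd, char k ≠ 2, and d is odd. -/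

import Mathlib

/-- Generators of the path algebra of the quiver `Q'`: idempotents `e v` for the vertices
(`some i` for `0 ≤ i ≤ m−1`, `none` for the extra vertex `−1`), and arrows
`a i : i → i+1`, `b i : i+1 → i`, `c i : i → −1`. -/
inductive GenA (m : ℕ) : Type
  | e : Option (ZMod m) → GenA m
  | a : ZMod m → GenA m
  | b : ZMod m → GenA m
  | c : ZMod m → GenA m

variable (k : Type) [Field k] (m : ℕ) [NeZero m] (q : ZMod m → k)

open FreeAlgebra in
/-- Relations presenting the Koszul dual `E(Γ_q)` as a quotient of the free algebra on the
generators: the path-algebra relations for the quiver `Q'` together with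
`q_i⁻¹ a_i b_i + b_{i−1} a_{i−1} = 0` and `b_i c_i = 0` (paths composed left to right). -/
inductive ERel : FreeAlgebra k (GenA m) → FreeAlgebra k (GenA m) → Prop
  | vert (v w : Option (ZMod m)) :
      ERel (ι k (GenA.e v) * ι k (GenA.e w)) (if v = w then ι k (GenA.e v) else 0)
  | unit : ERel (∑ v : Option (ZMod m), ι k (GenA.e v)) 1
  | srcA (i : ZMod m) : ERel (ι k (GenA.e (some i)) * ι k (GenA.a i)) (ι k (GenA.a i))
  | tgtA (i : ZMod m) : ERel (ι k (GenA.a i) * ι k (GenA.e (some (i+1)))) (ι k (GenA.a i))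
  | srcB (i : ZMod m) : ERel (ι k (GenA.e (some (i+1))) * ι k (GenA.b i)) (ι k (GenA.b i))
  | tgtB (i : ZMod m) : ERel (ι k (GenA.b i) * ι k (GenA.e (some i))) (ι k (GenA.b i))
  | srcC (i : ZMod m) : ERel (ι k (GenA.e (some i)) * ι k (GenA.c i)) (ι k (GenA.c i))
  | tgtC (i : ZMod m) : ERel (ι k (GenA.c i) * ι k (GenA.e none)) (ι k (GenA.c i))
  | relAB (i : ZMod m) :
      ERel ((q i)⁻¹ • (ι k (GenA.a i) * ι k (GenA.b i)) +
        ι k (GenA.b (i-1)) * ι k (GenA.a (i-1))) 0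
  | relBC (i : ZMod m) : ERel (ι k (GenA.b i) * ι k (GenA.c i)) 0

/-- The Koszul dual `E(Γ_q)`. -/
abbrev EΓ : Type := RingQuot (ERel k m q)

/-- The image of a generator in `E(Γ_q)`. -/
noncomputable def gE (g : GenA m) : EΓ k m q :=
  RingQuot.mkAlgHom k (ERel k m q) (FreeAlgebra.ι k g)

/-- Arrows, labelled by `Fin 3`: `0 ↦ a i`, `1 ↦ b i`, `2 ↦ c i`. -/
def arrA (p : ZMod m × Fin 3) : GenA m :=
  if p.2 = 0 then GenA.a p.1 else if p.2 = 1 then GenA.b p.1 else GenA.c p.1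

/-- The length-`l` homogeneous component of `E(Γ_q)` (the span of the paths of length `l`). -/
noncomputable def HboxA (l : ℕ) : Submodule k (EΓ k m q) :=
  Submodule.span k
    {x | ∃ (v : Option (ZMod m)) (L : List (ZMod m × Fin 3)), L.length = l ∧
      x = gE k m q (GenA.e v) * (L.map fun p => gE k m q (arrA m p)).prod}

/-- The graded centre `Z_gr(E(Γ_q))`: the subalgebra generated (equivalently, spanned) by the
length-homogeneous elements `z` with `z y = (−1)^{|z||y|} y z` for all length-homogeneous `y`. -/
noncomputable def ZgrA : Subalgebra k (EΓ k m q) :=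
  Algebra.adjoin k
    {z | ∃ l : ℕ, z ∈ HboxA k m q l ∧
      ∀ (l' : ℕ) (y : EΓ k m q), y ∈ HboxA k m q l' →
        z * y = ((-1 : k) ^ (l * l')) • (y * z)}


open MvPolynomial

/-- The commutative ring `k[x,y,w]/⟨w^p − ε x y⟩`. -/
abbrev QuotP (k : Type) [Field k] (p : ℕ) (ε : k) : Type :=
  MvPolynomial (Fin 3) k ⧸
    Ideal.span {(X 2 : MvPolynomial (Fin 3) k) ^ p - C ε * X 0 * X 1}

/-- The subalgebra `(k[x,y,w]/⟨w^p − ε x y⟩)_{x*}` of `k[x,y,w]/⟨w^p − ε x y⟩`, spanned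
(equivalently, generated) by the images of all monomials in `x, y, w` except the pure powers
`x^i`, `i ≥ 1`; i.e. generated by the monomials `x^i y^j w^l` with `j + l > 0`. -/
noncomputable def AstarP (k : Type) [Field k] (p : ℕ) (ε : k) : Subalgebra k (QuotP k p ε) :=
  Algebra.adjoin k
    {z | ∃ i j l : ℕ, 0 < j + l ∧
      z = Ideal.Quotient.mk _ ((X 0 : MvPolynomial (Fin 3) k) ^ i * X 1 ^ j * X 2 ^ l)}

/-- `q_{k} q_{k+1} ⋯ q_{k+c−1}` for a natural number `k` (taken mod `m`). -/
def qprod (k : Type) [Field k] (m : ℕ) [NeZero m] (q : ZMod m → k) (k' c : ℕ) : k :=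
  ∏ t ∈ Finset.range c, q ((k' : ZMod m) + (t : ZMod m))

namespace KoszulDual

set_option linter.unusedSectionVars false

variable {k m}

/-- Normal forms of paths: `p i s t` is `a^s b^t` starting at `i`, `c i s` is `a^s c` starting
at `i`, and `o` is the trivial path at the extra vertex. -/
inductive NF (m : ℕ) : Type
  | p (i : ZMod m) (s t : ℕ) : NF m
  | c (i : ZMod m) (s : ℕ) : NF m
  | o : NF m

/-- The starting vertex of a normal form. -/
def NF.src : NF m → Option (ZMod m)
  | .p i _ _ => some i
  | .c i _ => some i
  | .o => none

/-- The length of a normal form. -/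
def NF.deg : NF m → ℕ
  | .p _ s t => s + t
  | .c _ s => s + 1
  | .o => 0


/-- The scalar with `b_i a^s = κ i s • a^s b`. -/
def κ (i : ZMod m) (s : ℕ) : k := ∏ r ∈ Finset.range s, -(q (i + 1 + (r : ZMod m)))⁻¹

/-- The scalar with `b^t a^s = K i t s • a^s b^t`, where `b^t` ends at `i`. -/
def K (i : ZMod m) (t s : ℕ) : k := ∏ r ∈ Finset.range t, κ q (i + (r : ZMod m)) s

open Finsupp in
/-- Left multiplication of a normal form by a generator. -/
noncomputable def actOn : GenA m → NF m → (NF m →₀ k)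
  | .e v, n => if n.src = v then single n 1 else 0
  | .a j, .p i s t => if i = j + 1 then single (.p j (s + 1) t) 1 else 0
  | .a j, .c i s => if i = j + 1 then single (.c j (s + 1)) 1 else 0
  | .a _, .o => 0
  | .b j, .p i s t => if i = j then single (.p (j + 1) s (t + 1)) (κ q j s) else 0
  | .b _, .c _ _ => 0
  | .b _, .o => 0
  | .c _, .p _ _ _ => 0
  | .c _, .c _ _ => 0
  | .c j, .o => single (.c j 0) 1

theorem κ_zero (i : ZMod m) : κ q i 0 = 1 := by simp [κ]

theorem κ_succ (i : ZMod m) (s : ℕ) : κ q i (s + 1) = -(q (i + 1))⁻¹ * κ q (i + 1) s := by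
  simp only [κ, Finset.prod_range_succ', Nat.cast_zero, add_zero]
  rw [mul_comm]
  congr 1
  refine Finset.prod_congr rfl fun r _ => ?_
  push_cast
  rw [add_assoc (i + 1), add_comm (1 : ZMod m)]

/-- The left regular representation, as an action of the free algebra. -/
noncomputable def freeAct : FreeAlgebra k (GenA m) →ₐ[k] Module.End k (NF m →₀ k) :=
  FreeAlgebra.lift k fun g => Finsupp.linearCombination k (actOn q g)

theorem freeAct_ι (g : GenA m) (n : NF m) (x : k) :
    freeAct q (FreeAlgebra.ι k g) (Finsupp.single n x) = x • actOn q g n := by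
  simp [freeAct]

theorem freeAct_rel ⦃x y : FreeAlgebra k (GenA m)⦄ (h : ERel k m q x y) :
    freeAct q x = freeAct q y := by
  refine Finsupp.lhom_ext fun n r => ?_
  cases h with
  | vert v w =>
    by_cases h : v = w
    · subst h
      by_cases h' : n.src = v <;> simp [freeAct_ι, actOn, h']
    · by_cases h' : n.src = w
      · have : n.src ≠ v := fun hv => h (hv.symm.trans h')
        simp [freeAct_ι, actOn, h, h', Ne.symm h]
      · simp [freeAct_ι, actOn, h, h']
  | unit => simp [freeAct_ι, actOn, LinearMap.sum_apply, -Fintype.sum_option]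
  | srcA i =>
    cases n <;> simp only [freeAct_ι, actOn, map_mul, Module.End.mul_apply, map_smul] <;>
      (try split_ifs) <;> simp [freeAct_ι, actOn, NF.src]
  | srcB i =>
    cases n <;> simp only [freeAct_ι, actOn, map_mul, Module.End.mul_apply, map_smul] <;>
      (try split_ifs) <;> simp [freeAct_ι, actOn, NF.src]
  | tgtA i =>
    cases n <;> simp only [freeAct_ι, actOn, map_mul, Module.End.mul_apply, map_smul] <;>
      (try split_ifs) <;> simp_all [freeAct_ι, actOn, NF.src]
  | tgtB i =>
    cases n <;> simp only [freeAct_ι, actOn, map_mul, Module.End.mul_apply, map_smul] <;>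
      (try split_ifs) <;> simp_all [freeAct_ι, actOn, NF.src]
  | srcC i => cases n <;> simp [freeAct_ι, actOn, NF.src]
  | tgtC i => cases n <;> simp [freeAct_ι, actOn, NF.src]
  | relAB i =>
    cases n with
    | p j s t =>
      by_cases h : j = i
      · subst h
        simp [freeAct_ι, actOn, κ_succ, -Finsupp.single_mul]
        rw [← Finsupp.single_neg, ← Finsupp.single_add, Finsupp.single_eq_zero]
        ring
      · simp [freeAct_ι, actOn, h]
    | c j s =>
      by_cases h : j = i <;> simp [freeAct_ι, actOn, h]
    | o => simp [freeAct_ι, actOn]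
  | relBC i => cases n <;> simp [freeAct_ι, actOn]

/-- The left regular representation of `E(Γ_q)` in terms of normal forms. -/
noncomputable def ρ : EΓ k m q →ₐ[k] Module.End k (NF m →₀ k) :=
  RingQuot.liftAlgHom k ⟨freeAct q, freeAct_rel q⟩

theorem ρ_gE (g : GenA m) (n : NF m) (x : k) :
    ρ q (gE k m q g) (Finsupp.single n x) = x • actOn q g n := by
  rw [ρ, gE, RingQuot.liftAlgHom_mkAlgHom_apply, freeAct_ι]

theorem mk_rel {x y : FreeAlgebra k (GenA m)} (h : ERel k m q x y) :
    RingQuot.mkAlgHom k (ERel k m q) x = RingQuot.mkAlgHom k (ERel k m q) y :=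
  RingQuot.mkAlgHom_rel k h

theorem e_mul_e (v w : Option (ZMod m)) :
    gE k m q (.e v) * gE k m q (.e w) = if v = w then gE k m q (.e v) else 0 := by
  have := mk_rel q (ERel.vert v w)
  split_ifs at this ⊢ <;> simpa [gE] using this

theorem sum_e : ∑ v : Option (ZMod m), gE k m q (.e v) = 1 := by
  simpa [gE, -Fintype.sum_option] using mk_rel q ERel.unit

theorem e_mul_a_self (i : ZMod m) : gE k m q (.e (some i)) * gE k m q (.a i) = gE k m q (.a i) := by
  simpa [gE] using mk_rel q (ERel.srcA i)

theorem a_mul_e_self (i : ZMod m) :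
    gE k m q (.a i) * gE k m q (.e (some (i + 1))) = gE k m q (.a i) := by
  simpa [gE] using mk_rel q (ERel.tgtA i)

theorem e_mul_b_self (i : ZMod m) :
    gE k m q (.e (some (i + 1))) * gE k m q (.b i) = gE k m q (.b i) := by
  simpa [gE] using mk_rel q (ERel.srcB i)

theorem b_mul_e_self (i : ZMod m) : gE k m q (.b i) * gE k m q (.e (some i)) = gE k m q (.b i) := by
  simpa [gE] using mk_rel q (ERel.tgtB i)

theorem e_mul_c_self (i : ZMod m) : gE k m q (.e (some i)) * gE k m q (.c i) = gE k m q (.c i) := by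
  simpa [gE] using mk_rel q (ERel.srcC i)

theorem c_mul_e_self (i : ZMod m) : gE k m q (.c i) * gE k m q (.e none) = gE k m q (.c i) := by
  simpa [gE] using mk_rel q (ERel.tgtC i)

theorem b_mul_a (i : ZMod m) :
    gE k m q (.b i) * gE k m q (.a i) =
      (-(q (i + 1))⁻¹) • (gE k m q (.a (i + 1)) * gE k m q (.b (i + 1))) := by
  have := mk_rel q (ERel.relAB (i + 1))
  simp only [map_add, map_smul, map_mul, map_zero, add_sub_cancel_right] at this
  refine add_left_cancel (this.trans ?_)
  simp only [gE, ← add_smul, add_neg_cancel, zero_smul]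

theorem b_mul_c (i : ZMod m) : gE k m q (.b i) * gE k m q (.c i) = 0 := by
  simpa [gE] using mk_rel q (ERel.relBC i)

/-- The sum of the arrows `a i`. -/
noncomputable def sumA : EΓ k m q := ∑ i, gE k m q (.a i)

/-- The sum of the arrows `b i`. -/
noncomputable def sumB : EΓ k m q := ∑ i, gE k m q (.b i)

/-- The sum of the arrows `c i`. -/
noncomputable def sumC : EΓ k m q := ∑ i, gE k m q (.c i)

theorem e_mul_a (v : Option (ZMod m)) (i : ZMod m) :
    gE k m q (.e v) * gE k m q (.a i) = if v = some i then gE k m q (.a i) else 0 := by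
  rw [← e_mul_a_self, ← mul_assoc, e_mul_e]
  split_ifs with h
  · rw [h]
  · rw [zero_mul]

theorem e_mul_b (v : Option (ZMod m)) (i : ZMod m) :
    gE k m q (.e v) * gE k m q (.b i) = if v = some (i + 1) then gE k m q (.b i) else 0 := by
  rw [← e_mul_b_self, ← mul_assoc, e_mul_e]
  split_ifs with h
  · rw [h]
  · rw [zero_mul]

theorem e_mul_c (v : Option (ZMod m)) (i : ZMod m) :
    gE k m q (.e v) * gE k m q (.c i) = if v = some i then gE k m q (.c i) else 0 := by
  rw [← e_mul_c_self, ← mul_assoc, e_mul_e]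
  split_ifs with h
  · rw [h]
  · rw [zero_mul]

theorem a_mul_e (i : ZMod m) (v : Option (ZMod m)) :
    gE k m q (.a i) * gE k m q (.e v) = if v = some (i + 1) then gE k m q (.a i) else 0 := by
  rw [← a_mul_e_self, mul_assoc, e_mul_e]
  split_ifs with h h' h' <;> simp_all

theorem b_mul_e (i : ZMod m) (v : Option (ZMod m)) :
    gE k m q (.b i) * gE k m q (.e v) = if v = some i then gE k m q (.b i) else 0 := by
  rw [← b_mul_e_self, mul_assoc, e_mul_e]
  split_ifs with h h' h' <;> simp_all

theorem c_mul_e (i : ZMod m) (v : Option (ZMod m)) :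
    gE k m q (.c i) * gE k m q (.e v) = if v = none then gE k m q (.c i) else 0 := by
  rw [← c_mul_e_self, mul_assoc, e_mul_e]
  split_ifs with h h' h' <;> simp_all

theorem e_mul_sumA (i : ZMod m) : gE k m q (.e (some i)) * sumA q = gE k m q (.a i) := by
  simp [sumA, Finset.mul_sum, e_mul_a]

theorem e_mul_sumB (i : ZMod m) : gE k m q (.e (some (i + 1))) * sumB q = gE k m q (.b i) := by
  simp [sumB, Finset.mul_sum, e_mul_b]

theorem e_mul_sumC (i : ZMod m) : gE k m q (.e (some i)) * sumC q = gE k m q (.c i) := by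
  simp [sumC, Finset.mul_sum, e_mul_c]

theorem b_mul_sumA (i : ZMod m) :
    gE k m q (.b i) * sumA q = gE k m q (.b i) * gE k m q (.a i) := by
  rw [← b_mul_e_self, mul_assoc, mul_assoc, e_mul_sumA, e_mul_a_self]

theorem sumB_mul_sumC : sumB q * sumC q = 0 := by
  simp only [sumB, Finset.sum_mul]
  refine Finset.sum_eq_zero fun i _ => ?_
  rw [← b_mul_e_self, mul_assoc, e_mul_sumC, b_mul_c]

theorem b_mul_sumA_pow (s : ℕ) (j : ZMod m) :
    gE k m q (.b j) * sumA q ^ s =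
      κ q j s • (gE k m q (.e (some (j + 1))) * sumA q ^ s * sumB q) := by
  induction s generalizing j with
  | zero => simp [κ_zero, e_mul_sumB]
  | succ s ih =>
    rw [pow_succ', ← mul_assoc, b_mul_sumA, b_mul_a, smul_mul_assoc, mul_assoc, ih,
      mul_smul_comm, κ_succ, mul_smul, ← mul_assoc, ← mul_assoc, a_mul_e_self,
      ← mul_assoc, e_mul_sumA]

/-- The element of `E(Γ_q)` represented by a normal form. -/
noncomputable def mon : NF m → EΓ k m q
  | .p i s t => gE k m q (.e (some i)) * sumA q ^ s * sumB q ^ t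
  | .c i s => gE k m q (.e (some i)) * sumA q ^ s * sumC q
  | .o => gE k m q (.e none)

/-- The linear map sending a normal form to the element it represents. -/
noncomputable def sec : (NF m →₀ k) →ₗ[k] EΓ k m q := Finsupp.linearCombination k (mon q)

theorem sec_single (n : NF m) (x : k) : sec q (Finsupp.single n x) = x • mon q n := by
  simp [sec]

theorem gE_mul_mon (g : GenA m) (n : NF m) : gE k m q g * mon q n = sec q (actOn q g n) := by
  cases g with
  | e v =>
    cases n <;> simp only [mon, ← mul_assoc, e_mul_e, actOn, NF.src, @eq_comm _ v] <;>
      split_ifs with h <;> simp [mon, sec_single, h]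
  | a j =>
    cases n with
    | p i s t =>
      simp only [mon, ← mul_assoc, a_mul_e, actOn, apply_ite (sec q), sec_single, one_smul,
        map_zero, Option.some_inj]
      split_ifs with h
      · rw [pow_succ', ← mul_assoc, e_mul_sumA]
      · simp
    | c i s =>
      simp only [mon, ← mul_assoc, a_mul_e, actOn, apply_ite (sec q), sec_single, one_smul,
        map_zero, Option.some_inj]
      split_ifs with h
      · rw [pow_succ', ← mul_assoc, e_mul_sumA]
      · simp
    | o => simp [mon, actOn, a_mul_e]
  | b j =>
    cases n with
    | p i s t =>
      simp only [mon, ← mul_assoc, b_mul_e, actOn, apply_ite (sec q), sec_single,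
        map_zero, Option.some_inj]
      split_ifs with h
      · rw [b_mul_sumA_pow, pow_succ', ← mul_assoc, smul_mul_assoc]
      · simp
    | c i s =>
      simp only [mon, ← mul_assoc, b_mul_e, actOn, map_zero]
      split_ifs with h
      · rw [b_mul_sumA_pow, smul_mul_assoc, mul_assoc, sumB_mul_sumC, mul_zero, smul_zero]
      · simp
    | o => simp [mon, actOn, b_mul_e]
  | c j =>
    cases n <;> simp [mon, ← mul_assoc, c_mul_e, actOn, sec_single, e_mul_sumC]

/-- To check a property of all elements of `E(Γ_q)`, it suffices to check generators. -/
theorem gE_induction {P : EΓ k m q → Prop} (x : EΓ k m q) (algebraMap : ∀ r, P (algebraMap k _ r))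
    (gen : ∀ g, P (gE k m q g)) (mul : ∀ x y, P x → P y → P (x * y))
    (add : ∀ x y, P x → P y → P (x + y)) : P x := by
  obtain ⟨x, rfl⟩ := RingQuot.mkAlgHom_surjective k (ERel k m q) x
  induction x using FreeAlgebra.induction with
  | grade0 r => simpa using algebraMap r
  | grade1 g => exact gen g
  | mul x y hx hy => simpa using mul _ _ hx hy
  | add x y hx hy => simpa using add _ _ hx hy

theorem sec_ρ (x : EΓ k m q) (v : NF m →₀ k) : sec q (ρ q x v) = x * sec q v := by
  induction x using gE_induction generalizing v with
  | algebraMap r => simp [Algebra.algebraMap_eq_smul_one]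
  | gen g =>
    induction v using Finsupp.induction_linear with
    | zero => simp
    | add f g hf hg => simp [hf, hg, mul_add]
    | single n r => rw [ρ_gE, map_smul, sec_single, mul_smul_comm, gE_mul_mon]
  | mul x y hx hy => rw [map_mul, Module.End.mul_apply, hx, hy, mul_assoc]
  | add x y hx hy => rw [map_add, LinearMap.add_apply, map_add, hx, hy, add_mul]

/-- The sum of the trivial paths. -/
noncomputable def unitVec : NF m →₀ k :=
  ∑ i : ZMod m, Finsupp.single (.p i 0 0) 1 + Finsupp.single .o 1

/-- The coordinates of an element of `E(Γ_q)` with respect to the normal forms. -/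
noncomputable def co : EΓ k m q →ₗ[k] (NF m →₀ k) := (ρ q).toLinearMap.flip unitVec

theorem co_apply (x : EΓ k m q) : co q x = ρ q x unitVec := rfl

theorem co_mul (x y : EΓ k m q) : co q (x * y) = ρ q x (co q y) := by
  simp [co_apply]

theorem sec_co (x : EΓ k m q) : sec q (co q x) = x := by
  have : sec q unitVec = 1 := by
    rw [← sum_e q, Fintype.sum_option, add_comm]
    simp [unitVec, sec_single, mon]
  rw [co_apply, sec_ρ, this, mul_one]

theorem co_injective : Function.Injective (co q) :=
  Function.LeftInverse.injective (sec_co q)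

/-- The element `∑ i, f i • e i`. -/
noncomputable def diag (f : ZMod m → k) : EΓ k m q := ∑ i, f i • gE k m q (.e (some i))

/-- The element `∑ i, f i • e i a^s b^t`. -/
noncomputable def bimon (f : ZMod m → k) (s t : ℕ) : EΓ k m q :=
  diag q f * sumA q ^ s * sumB q ^ t

theorem K_zero_right (i : ZMod m) (t : ℕ) : K q i t 0 = 1 := by simp [K, κ_zero]

theorem K_zero_left (i : ZMod m) (s : ℕ) : K q i 0 s = 1 := by simp [K]

theorem K_succ_left (i : ZMod m) (t s : ℕ) :
    K q i (t + 1) s = K q i t s * κ q (i + (t : ZMod m)) s := by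
  simp [K, Finset.prod_range_succ]

theorem ρ_diag_p (f : ZMod m → k) (i : ZMod m) (s t : ℕ) (x : k) :
    ρ q (diag q f) (Finsupp.single (.p i s t) x) = Finsupp.single (.p i s t) (f i * x) := by
  simp [diag, LinearMap.sum_apply, ρ_gE, actOn, NF.src, -Finsupp.single_mul]

theorem ρ_diag_o (f : ZMod m → k) (x : k) : ρ q (diag q f) (Finsupp.single .o x) = 0 := by
  simp [diag, LinearMap.sum_apply, ρ_gE, actOn, NF.src]

theorem ρ_sumA_p (i : ZMod m) (s t : ℕ) (x : k) :
    ρ q (sumA q) (Finsupp.single (.p i s t) x) = Finsupp.single (.p (i - 1) (s + 1) t) x := by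
  simp only [sumA, map_sum, LinearMap.sum_apply, ρ_gE, actOn]
  rw [Finset.sum_eq_single (i - 1)] <;> simp +contextual [eq_sub_iff_add_eq, eq_comm]

theorem ρ_sumA_c (i : ZMod m) (s : ℕ) (x : k) :
    ρ q (sumA q) (Finsupp.single (.c i s) x) = Finsupp.single (.c (i - 1) (s + 1)) x := by
  simp only [sumA, map_sum, LinearMap.sum_apply, ρ_gE, actOn]
  rw [Finset.sum_eq_single (i - 1)] <;> simp +contextual [eq_sub_iff_add_eq, eq_comm]

theorem ρ_sumA_o (x : k) : ρ q (sumA q) (Finsupp.single .o x) = 0 := by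
  simp [sumA, LinearMap.sum_apply, ρ_gE, actOn]

theorem ρ_sumB_p (i : ZMod m) (s t : ℕ) (x : k) :
    ρ q (sumB q) (Finsupp.single (.p i s t) x) =
      Finsupp.single (.p (i + 1) s (t + 1)) (κ q i s * x) := by
  simp [sumB, LinearMap.sum_apply, ρ_gE, actOn, -Finsupp.single_mul, mul_comm]

theorem ρ_sumB_o (x : k) : ρ q (sumB q) (Finsupp.single .o x) = 0 := by
  simp [sumB, LinearMap.sum_apply, ρ_gE, actOn]

theorem ρ_sumC_p (i : ZMod m) (s t : ℕ) (x : k) :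
    ρ q (sumC q) (Finsupp.single (.p i s t) x) = 0 := by
  simp [sumC, LinearMap.sum_apply, ρ_gE, actOn]

theorem ρ_sumC_c (i : ZMod m) (s : ℕ) (x : k) :
    ρ q (sumC q) (Finsupp.single (.c i s) x) = 0 := by
  simp [sumC, LinearMap.sum_apply, ρ_gE, actOn]

theorem ρ_sumC_o (x : k) :
    ρ q (sumC q) (Finsupp.single .o x) = ∑ i, Finsupp.single (.c i 0) x := by
  simp [sumC, LinearMap.sum_apply, ρ_gE, actOn]

theorem ρ_sumA_pow_p (n : ℕ) (i : ZMod m) (s t : ℕ) (x : k) :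
    ρ q (sumA q ^ n) (Finsupp.single (.p i s t) x) =
      Finsupp.single (.p (i - (n : ZMod m)) (s + n) t) x := by
  induction n with
  | zero => simp
  | succ n ih =>
    rw [pow_succ', map_mul, Module.End.mul_apply, ih, ρ_sumA_p]
    push_cast
    rw [sub_sub, add_assoc]

theorem ρ_sumA_pow_c (n : ℕ) (i : ZMod m) (s : ℕ) (x : k) :
    ρ q (sumA q ^ n) (Finsupp.single (.c i s) x) =
      Finsupp.single (.c (i - (n : ZMod m)) (s + n)) x := by
  induction n with
  | zero => simp
  | succ n ih =>
    rw [pow_succ', map_mul, Module.End.mul_apply, ih, ρ_sumA_c]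
    push_cast
    rw [sub_sub, add_assoc]

theorem ρ_sumB_pow_p (n : ℕ) (i : ZMod m) (s t : ℕ) (x : k) :
    ρ q (sumB q ^ n) (Finsupp.single (.p i s t) x) =
      Finsupp.single (.p (i + (n : ZMod m)) s (t + n)) (K q i n s * x) := by
  induction n with
  | zero => simp [K_zero_left]
  | succ n ih =>
    rw [pow_succ', map_mul, Module.End.mul_apply, ih, ρ_sumB_p, K_succ_left]
    push_cast
    rw [add_assoc, add_assoc, mul_left_comm, mul_assoc]

theorem ρ_bimon_p (f : ZMod m → k) (s t : ℕ) (i : ZMod m) (s' t' : ℕ) (x : k) :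
    ρ q (bimon q f s t) (Finsupp.single (.p i s' t') x) =
      Finsupp.single (.p (i + (t : ZMod m) - (s : ZMod m)) (s + s') (t + t'))
        (f (i + (t : ZMod m) - (s : ZMod m)) * K q i t s' * x) := by
  rw [bimon, map_mul, map_mul, Module.End.mul_apply, Module.End.mul_apply, ρ_sumB_pow_p,
    ρ_sumA_pow_p, ρ_diag_p, add_comm s', add_comm t', mul_assoc]

theorem ρ_bimon_o (f : ZMod m → k) (s t : ℕ) (x : k) :
    ρ q (bimon q f s t) (Finsupp.single .o x) = 0 := by
  rw [bimon, map_mul, map_mul, Module.End.mul_apply, Module.End.mul_apply]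
  rcases t with _ | t
  · rcases s with _ | s
    · simp [ρ_diag_o]
    · simp [pow_succ, ρ_sumA_o]
  · simp [pow_succ, ρ_sumB_o]

theorem co_bimon (f : ZMod m → k) (s t : ℕ) :
    co q (bimon q f s t) = ∑ i, Finsupp.single (.p i s t) (f i) := by
  rw [co_apply, unitVec, map_add, ρ_bimon_o, add_zero, map_sum]
  simp only [ρ_bimon_p, K_zero_right, add_zero, mul_one, add_sub_assoc]
  exact Equiv.sum_comp (Equiv.addRight ((t : ZMod m) - (s : ZMod m)))
    (fun i => Finsupp.single (NF.p i s t) (f i))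

theorem co_bimon_p (f : ZMod m → k) (s t : ℕ) (i : ZMod m) (s' t' : ℕ) :
    co q (bimon q f s t) (.p i s' t') = if s = s' ∧ t = t' then f i else 0 := by
  classical
  rw [co_bimon, Finsupp.finsetSum_apply]
  simp only [Finsupp.single_apply, NF.p.injEq, ite_and]
  simp

theorem co_bimon_c (f : ZMod m → k) (s t : ℕ) (i : ZMod m) (s' : ℕ) :
    co q (bimon q f s t) (.c i s') = 0 := by
  simp [co_bimon, Finsupp.finsetSum_apply]

theorem co_bimon_o (f : ZMod m → k) (s t : ℕ) : co q (bimon q f s t) .o = 0 := by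
  simp [co_bimon, Finsupp.finsetSum_apply]

theorem bimon_mul_bimon (f g : ZMod m → k) (s t s' t' : ℕ) :
    bimon q f s t * bimon q g s' t' =
      bimon q (fun i => f i * K q (i + (s : ZMod m) - (t : ZMod m)) t s' *
        g (i + (s : ZMod m) - (t : ZMod m))) (s + s') (t + t') := by
  apply co_injective
  rw [co_mul, co_bimon, co_bimon, map_sum]
  simp only [ρ_bimon_p]
  rw [← Equiv.sum_comp (Equiv.addRight ((s : ZMod m) - (t : ZMod m)))]
  refine Finset.sum_congr rfl fun i _ => ?_
  have h : i + ((s : ZMod m) - (t : ZMod m)) + (t : ZMod m) - (s : ZMod m) = i := by ring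
  simp only [Equiv.coe_addRight, h, add_sub_assoc]

theorem diag_one_add : diag q 1 + gE k m q (.e none) = 1 := by
  rw [← sum_e q, Fintype.sum_option, add_comm]
  simp [diag]

theorem e_eq_bimon (i : ZMod m) : gE k m q (.e (some i)) = bimon q (Pi.single i 1) 0 0 := by
  simp [bimon, diag, Pi.single_apply]

theorem e_none_mul_sumA : gE k m q (.e none) * sumA q = 0 := by
  simp [sumA, Finset.mul_sum, e_mul_a]

theorem e_none_mul_sumB : gE k m q (.e none) * sumB q = 0 := by
  simp [sumB, Finset.mul_sum, e_mul_b]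

theorem e_none_mul_diag (f : ZMod m → k) : gE k m q (.e none) * diag q f = 0 := by
  simp [diag, Finset.mul_sum, e_mul_e]

theorem diag_mul_e_none (f : ZMod m → k) : diag q f * gE k m q (.e none) = 0 := by
  simp [diag, Finset.sum_mul, e_mul_e]

theorem sumA_mul_e_none : sumA q * gE k m q (.e none) = 0 := by
  simp [sumA, Finset.sum_mul, a_mul_e]

theorem sumB_mul_e_none : sumB q * gE k m q (.e none) = 0 := by
  simp [sumB, Finset.sum_mul, b_mul_e]

theorem sumC_mul_e_none : sumC q * gE k m q (.e none) = sumC q := by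
  simp [sumC, Finset.sum_mul, c_mul_e]

theorem diag_one_mul_sumA : diag q 1 * sumA q = sumA q := by
  simpa [add_mul, e_none_mul_sumA] using congrArg (· * sumA q) (diag_one_add q)

theorem diag_one_mul_sumB : diag q 1 * sumB q = sumB q := by
  simpa [add_mul, e_none_mul_sumB] using congrArg (· * sumB q) (diag_one_add q)

theorem sumA_eq_bimon : sumA q = bimon q 1 1 0 := by
  simp [bimon, diag_one_mul_sumA]

theorem sumB_eq_bimon : sumB q = bimon q 1 0 1 := by
  simp [bimon, diag_one_mul_sumB]

theorem e_none_mul_bimon (f : ZMod m → k) (s t : ℕ) :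
    gE k m q (.e none) * bimon q f s t = 0 := by
  rw [bimon, ← mul_assoc, ← mul_assoc, e_none_mul_diag, zero_mul, zero_mul]

theorem bimon_mul_e_none (f : ZMod m → k) (s t : ℕ) :
    bimon q f s t * gE k m q (.e none) = 0 := by
  rw [bimon]
  rcases t with _ | t
  · rcases s with _ | s
    · simp [diag_mul_e_none]
    · simp [pow_succ, mul_assoc, sumA_mul_e_none]
  · simp [pow_succ, mul_assoc, sumB_mul_e_none]

theorem sumC_mul_bimon (f : ZMod m → k) (s t : ℕ) : sumC q * bimon q f s t = 0 := by
  rw [← sumC_mul_e_none, mul_assoc, e_none_mul_bimon, mul_zero]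

theorem bimon_mul_sumC (f : ZMod m → k) (s : ℕ) {t : ℕ} (ht : 0 < t) :
    bimon q f s t * sumC q = 0 := by
  obtain ⟨t, rfl⟩ := Nat.exists_eq_succ_of_ne_zero ht.ne'
  rw [bimon, pow_succ, mul_assoc, mul_assoc (sumB q ^ t), sumB_mul_sumC, mul_zero, mul_zero]

theorem mon_p_eq (i : ZMod m) (s t : ℕ) : mon q (.p i s t) = bimon q (Pi.single i 1) s t := by
  rw [mon, bimon, e_eq_bimon, bimon]
  simp

theorem co_mon (n : NF m) : co q (mon q n) = Finsupp.single n 1 := by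
  classical
  cases n with
  | p i s t =>
    rw [mon_p_eq, co_bimon, Finset.sum_eq_single i] <;> simp +contextual
  | c i s =>
    rw [mon, e_eq_bimon, co_mul, co_apply, unitVec, map_add, map_sum]
    simp only [ρ_sumC_p, ρ_sumC_o, Finset.sum_const_zero, zero_add, map_sum, map_mul,
      Module.End.mul_apply, ρ_sumA_pow_c, ← e_eq_bimon, ρ_gE, actOn, NF.src, Option.some_inj,
      one_smul]
    rw [Finset.sum_eq_single (i + (s : ZMod m))] <;>
      simp +contextual [sub_eq_iff_eq_add]
  | o =>
    rw [mon, co_apply, unitVec, map_add, map_sum]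
    simp [ρ_gE, actOn, NF.src]

/-- Linear functionals on `E(Γ_q)` agree if they agree on normal forms. -/
theorem ext_mon {φ ψ : EΓ k m q →ₗ[k] k} (h : ∀ n, φ (mon q n) = ψ (mon q n)) (z : EΓ k m q) :
    φ z = ψ z := by
  rw [← sec_co q z]
  induction co q z using Finsupp.induction_linear with
  | zero => simp
  | add f g hf hg => simp [hf, hg]
  | single n r => simp [sec_single, h]

theorem mon_c_mul_bimon (i : ZMod m) (s : ℕ) (f : ZMod m → k) (s' t' : ℕ) :
    mon q (.c i s) * bimon q f s' t' = 0 := by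
  rw [mon, mul_assoc, sumC_mul_bimon, mul_zero]

theorem mon_o_mul_bimon (f : ZMod m → k) (s' t' : ℕ) : mon q .o * bimon q f s' t' = 0 :=
  e_none_mul_bimon q f s' t'

theorem e_none_mul_sumC : gE k m q (.e none) * sumC q = 0 := by
  simp [sumC, Finset.mul_sum, e_mul_c]

theorem co_mul_e_p (z : EΓ k m q) (i j : ZMod m) (s t : ℕ) :
    co q (z * gE k m q (.e (some j))) (.p i s t) =
      if i + (s : ZMod m) - (t : ZMod m) = j then co q z (.p i s t) else 0 := by
  classical
  refine (ext_mon q (φ := Finsupp.lapply (.p i s t) ∘ₗ co q ∘ₗ LinearMap.mulRight k _)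
    (ψ := (if i + (s : ZMod m) - (t : ZMod m) = j then (1 : k) else 0) •
      (Finsupp.lapply (.p i s t) ∘ₗ co q)) (fun n => ?_) z).trans
      (by by_cases h : i + (s : ZMod m) - (t : ZMod m) = j <;> simp [h])
  cases n with
  | p i' s' t' =>
    simp only [LinearMap.comp_apply, LinearMap.mulRight_apply, mon_p_eq, e_eq_bimon,
      bimon_mul_bimon, Finsupp.lapply_apply, co_bimon_p, LinearMap.smul_apply, add_zero,
      K_zero_right, mul_one, Pi.single_apply, smul_eq_mul]
    by_cases h : s' = s ∧ t' = t
    · obtain ⟨rfl, rfl⟩ := h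
      simp [mul_comm]
    · simp [h]
  | c i' s' =>
    rw [LinearMap.smul_apply]
    simp [e_eq_bimon, mon_c_mul_bimon, co_mon]
  | o =>
    rw [LinearMap.smul_apply]
    simp [e_eq_bimon, mon_o_mul_bimon, co_mon]

theorem co_mul_e_none_c (z : EΓ k m q) (i : ZMod m) (s : ℕ) :
    co q (z * gE k m q (.e none)) (.c i s) = co q z (.c i s) := by
  refine (ext_mon q (φ := Finsupp.lapply (.c i s) ∘ₗ co q ∘ₗ LinearMap.mulRight k _)
    (ψ := Finsupp.lapply (.c i s) ∘ₗ co q) (fun n => ?_) z)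
  cases n with
  | p i' s' t' => simp [mon_p_eq, bimon_mul_e_none, co_bimon_c]
  | c i' s' => simp [mon, mul_assoc, sumC_mul_e_none]
  | o => simp [mon, e_mul_e]

theorem co_mul_sumA_p (z : EΓ k m q) (i : ZMod m) (s t : ℕ) :
    co q (z * sumA q) (.p i (s + 1) t) =
      K q (i + (s : ZMod m) - (t : ZMod m)) t 1 * co q z (.p i s t) := by
  classical
  refine (ext_mon q (φ := Finsupp.lapply (.p i (s + 1) t) ∘ₗ co q ∘ₗ LinearMap.mulRight k _)
    (ψ := K q (i + (s : ZMod m) - (t : ZMod m)) t 1 •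
      (Finsupp.lapply (.p i s t) ∘ₗ co q)) (fun n => ?_) z).trans (by simp)
  cases n with
  | p i' s' t' =>
    simp only [LinearMap.comp_apply, LinearMap.mulRight_apply, mon_p_eq, sumA_eq_bimon,
      bimon_mul_bimon, Finsupp.lapply_apply, co_bimon_p, LinearMap.smul_apply, add_zero,
      Pi.one_apply, mul_one, Pi.single_apply, smul_eq_mul, add_left_inj]
    by_cases h : s' = s ∧ t' = t
    · obtain ⟨rfl, rfl⟩ := h
      simp
    · simp [h]
  | c i' s' => simp [sumA_eq_bimon, mon_c_mul_bimon, co_mon]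
  | o => simp [sumA_eq_bimon, mon_o_mul_bimon, co_mon]

theorem co_mul_sumB_p (z : EΓ k m q) (i : ZMod m) (s t : ℕ) :
    co q (z * sumB q) (.p i s (t + 1)) = co q z (.p i s t) := by
  classical
  refine (ext_mon q (φ := Finsupp.lapply (.p i s (t + 1)) ∘ₗ co q ∘ₗ LinearMap.mulRight k _)
    (ψ := Finsupp.lapply (.p i s t) ∘ₗ co q) (fun n => ?_) z)
  cases n with
  | p i' s' t' =>
    simp only [LinearMap.comp_apply, LinearMap.mulRight_apply, mon_p_eq, sumB_eq_bimon,
      bimon_mul_bimon, Finsupp.lapply_apply, co_bimon_p, add_zero, K_zero_right,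
      Pi.one_apply, mul_one, add_left_inj]
  | c i' s' => simp [sumB_eq_bimon, mon_c_mul_bimon, co_mon]
  | o => simp [sumB_eq_bimon, mon_o_mul_bimon, co_mon]

theorem co_mul_sumC_c (z : EΓ k m q) (i : ZMod m) (s : ℕ) :
    co q (z * sumC q) (.c i s) = co q z (.p i s 0) := by
  classical
  refine (ext_mon q (φ := Finsupp.lapply (.c i s) ∘ₗ co q ∘ₗ LinearMap.mulRight k _)
    (ψ := Finsupp.lapply (.p i s 0) ∘ₗ co q) (fun n => ?_) z)
  have hCC : sumC q * sumC q = 0 := by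
    conv_lhs => rw [← sumC_mul_e_none, mul_assoc, sumC_mul_e_none, e_none_mul_sumC, mul_zero]
  cases n with
  | p i' s' t' =>
    rcases t' with _ | t'
    · have : mon q (.p i' s' 0) * sumC q = mon q (.c i' s') := by simp [mon]
      simp [this, co_mon, Finsupp.single_apply]
    · simp [mon_p_eq, bimon_mul_sumC, co_bimon_p]
  | c i' s' =>
    have : mon q (.c i' s') * sumC q = 0 := by rw [mon, mul_assoc, hCC, mul_zero]
    simp [this, co_mon]
  | o =>
    have : mon q (m := m) .o * sumC q = 0 := e_none_mul_sumC q
    simp [this, co_mon]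

theorem ρ_e_apply (v : Option (ZMod m)) (x : NF m →₀ k) (n : NF m) :
    ρ q (gE k m q (.e v)) x n = if n.src = v then x n else 0 := by
  classical
  induction x using Finsupp.induction_linear with
  | zero => simp
  | add f g hf hg => rw [map_add, Finsupp.add_apply, hf, hg, Finsupp.add_apply]; split_ifs <;> simp
  | single n' r =>
    simp only [ρ_gE, actOn, Finsupp.single_apply]
    by_cases h : n' = n
    · subst h; split_ifs <;> simp_all
    · split_ifs <;> simp [h]

theorem ρ_sumA_apply (x : NF m →₀ k) (i : ZMod m) (s t : ℕ) :
    ρ q (sumA q) x (.p i (s + 1) t) = x (.p (i + 1) s t) := by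
  classical
  induction x using Finsupp.induction_linear with
  | zero => simp
  | add f g hf hg => rw [map_add, Finsupp.add_apply, hf, hg, Finsupp.add_apply]
  | single n' r =>
    cases n' <;> simp [ρ_sumA_p, ρ_sumA_c, ρ_sumA_o, Finsupp.single_apply, sub_eq_iff_eq_add]

theorem ρ_sumB_c (i : ZMod m) (s : ℕ) (x : k) : ρ q (sumB q) (Finsupp.single (.c i s) x) = 0 := by
  simp [sumB, LinearMap.sum_apply, ρ_gE, actOn]

theorem ρ_sumB_apply (x : NF m →₀ k) (i : ZMod m) (s t : ℕ) :
    ρ q (sumB q) x (.p (i + 1) s (t + 1)) = κ q i s * x (.p i s t) := by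
  classical
  induction x using Finsupp.induction_linear with
  | zero => simp
  | add f g hf hg => rw [map_add, Finsupp.add_apply, hf, hg, Finsupp.add_apply, mul_add]
  | single n' r =>
    cases n' with
    | p i' s' t' =>
      rw [ρ_sumB_p, Finsupp.single_apply, Finsupp.single_apply]
      simp only [NF.p.injEq, add_left_inj]
      by_cases h : i' = i ∧ s' = s ∧ t' = t
      · obtain ⟨rfl, rfl, rfl⟩ := h
        simp
      · simp [h]
    | c i' s' => simp [ρ_sumB_c]
    | o => simp [ρ_sumB_o]

theorem ρ_sumC_apply (x : NF m →₀ k) (i : ZMod m) (s : ℕ) :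
    ρ q (sumC q) x (.c i s) = if s = 0 then x .o else 0 := by
  classical
  induction x using Finsupp.induction_linear with
  | zero => simp
  | add f g hf hg => rw [map_add, Finsupp.add_apply, hf, hg, Finsupp.add_apply]; split_ifs <;> simp
  | single n' r =>
    cases n' with
    | p => simp [ρ_sumC_p]
    | c => simp [ρ_sumC_c]
    | o =>
      rw [ρ_sumC_o, Finsupp.finsetSum_apply, Finset.sum_eq_single i] <;>
        simp +contextual [Finsupp.single_apply, eq_comm]

/-- Elements whose coordinates live on normal forms of length `l`. -/
theorem deg_of_mem {l : ℕ} {z : EΓ k m q} (hz : z ∈ HboxA k m q l) {n : NF m}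
    (hn : co q z n ≠ 0) : n.deg = l := by
  classical
  let S : ℕ → Submodule k (NF m →₀ k) := fun l => Finsupp.supported k k {n | n.deg = l}
  have hS : ∀ (l l' : ℕ) (y : EΓ k m q) (g : GenA m) (_ : ∀ n, actOn q g n ∈ S (n.deg + l'))
      (_ : co q y ∈ S l), co q (gE k m q g * y) ∈ S (l + l') := by
    intro l l' y g hg hy
    rw [co_mul]
    have : S l ≤ (S (l + l')).comap (ρ q (gE k m q g)) := by
      simp only [S]
      rw [Finsupp.supported_eq_span_single, Submodule.span_le]
      rintro _ ⟨n, rfl, rfl⟩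
      simpa [ρ_gE] using hg n
    exact this hy
  have h1 : ∀ L : List (ZMod m × Fin 3),
      co q (L.map fun p => gE k m q (arrA m p)).prod ∈ S L.length := by
    intro L
    induction L with
    | nil =>
      rw [List.map_nil, List.prod_nil, co_apply, map_one, Module.End.one_apply, unitVec]
      refine add_mem (sum_mem fun i _ => ?_) ?_ <;>
        exact Finsupp.single_mem_supported k _ rfl
    | cons p L ih =>
      rw [List.map_cons, List.prod_cons, List.length_cons]
      refine hS _ 1 _ _ (fun n => ?_) ih
      have hs : ∀ (n' : NF m) (x : k), n'.deg = n.deg + 1 → Finsupp.single n' x ∈ S (n.deg + 1) :=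
        fun n' x h => Finsupp.single_mem_supported k _ h
      unfold arrA
      split_ifs <;> cases n <;> simp only [actOn] <;> (try split_ifs) <;>
        first
          | exact zero_mem _
          | (apply hs; simp only [NF.deg] <;> ring)
  have h2 : HboxA k m q l ≤ (S l).comap (co q) := by
    rw [HboxA, Submodule.span_le]
    rintro _ ⟨v, L, rfl, rfl⟩
    refine hS L.length 0 _ _ (fun n => ?_) (h1 L)
    simp only [actOn]
    split_ifs
    · exact Finsupp.single_mem_supported k _ rfl
    · exact zero_mem _
  exact (Finsupp.mem_supported k _).1 (h2 hz) (Finsupp.mem_support_iff.2 hn)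

theorem K_one_right (i : ZMod m) (t : ℕ) : K q i t 1 = κ q i t := by
  simp [K, κ, add_right_comm]

theorem K_one_left (i : ZMod m) (s : ℕ) : K q i 1 s = κ q i s := by
  simp [K]

variable {q} in
theorem κ_ne_zero (hq : ∀ i, q i ≠ 0) (i : ZMod m) (s : ℕ) : κ q i s ≠ 0 :=
  Finset.prod_ne_zero_iff.2 fun _ _ => neg_ne_zero.2 (inv_ne_zero (hq _))

variable {q} in
theorem K_ne_zero (hq : ∀ i, q i ≠ 0) (i : ZMod m) (t s : ℕ) : K q i t s ≠ 0 :=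
  Finset.prod_ne_zero_iff.2 fun _ _ => κ_ne_zero hq _ _

theorem prod_range_natCast (f : ZMod m → k) (i : ZMod m) :
    ∏ r ∈ Finset.range m, f (i + (r : ZMod m)) = ∏ j, f j := by
  rw [← Equiv.prod_comp (Equiv.addLeft i)]
  exact Finset.prod_nbij' (fun r => (r : ZMod m)) ZMod.val (by simp)
    (by simpa using fun a => ZMod.val_lt a)
    (fun r hr => ZMod.val_cast_of_lt (Finset.mem_range.1 hr)) (by simp) (by simp)

/-- The holonomy `∏ i, -(q i)⁻¹`. -/
def hol : k := ∏ i, -(q i)⁻¹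

theorem κ_add (i : ZMod m) (s t : ℕ) : κ q i (s + t) = κ q i s * κ q (i + (s : ZMod m)) t := by
  simp [κ, Finset.prod_range_add, add_assoc, add_left_comm, add_comm]

theorem κ_self (i : ZMod m) : κ q i m = hol q :=
  prod_range_natCast (fun j => -(q j)⁻¹) (i + 1)

theorem κ_mul (i : ZMod m) (u : ℕ) : κ q i (m * u) = hol q ^ u := by
  induction u with
  | zero => simp [κ_zero]
  | succ u ih => rw [mul_add, mul_one, κ_add, ih, κ_self, pow_succ]

theorem prod_κ (t : ℕ) : ∏ i, κ q i t = hol q ^ t := by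
  simp only [κ]
  rw [Finset.prod_comm, ← Finset.card_range t, ← Finset.prod_const, Finset.card_range]
  refine Finset.prod_congr rfl fun r _ => ?_
  have := Equiv.prod_comp (Equiv.addRight (1 + (r : ZMod m))) (fun j => -(q j)⁻¹)
  simpa [add_assoc, hol] using this

theorem rec_iterate {r f : ZMod m → k} (h : ∀ i, f (i + 1) = r i * f i) (i : ZMod m) (n : ℕ) :
    f (i + (n : ZMod m)) = (∏ j ∈ Finset.range n, r (i + (j : ZMod m))) * f i := by
  induction n with
  | zero => simp
  | succ n ih =>
    rw [Nat.cast_succ, ← add_assoc, h, ih, Finset.prod_range_succ]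
    ring

theorem prod_eq_one_of_rec {r f : ZMod m → k} (h : ∀ i, f (i + 1) = r i * f i) {i : ZMod m}
    (hi : f i ≠ 0) : ∏ j, r j = 1 := by
  have := rec_iterate h i m
  rw [prod_range_natCast, ZMod.natCast_self, add_zero] at this
  exact mul_right_cancel₀ hi (by rw [one_mul]; exact this.symm)

theorem eq_smul_of_rec {r f g : ZMod m → k} (hf : ∀ i, f (i + 1) = r i * f i)
    (hg : ∀ i, g (i + 1) = r i * g i) (h0 : g 0 ≠ 0) : f = (f 0 / g 0) • g := by
  ext i
  have h1 := rec_iterate hf 0 i.val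
  have h2 := rec_iterate hg 0 i.val
  rw [ZMod.natCast_zmod_val, zero_add] at h1 h2
  rw [h1, Pi.smul_apply, h2, smul_eq_mul]
  field_simp

theorem exists_rec {r : ZMod m → k} (hr : ∏ j, r j = 1) :
    ∃ f : ZMod m → k, (∀ i, f i ≠ 0) ∧ ∀ i, f (i + 1) = r i * f i := by
  have h2 : ∀ i, r i ≠ 0 := fun i hi => by
    rw [Finset.prod_eq_zero (Finset.mem_univ i) hi] at hr
    exact zero_ne_one hr
  refine ⟨fun i => ∏ j ∈ Finset.range i.val, r j, fun i =>
    Finset.prod_ne_zero_iff.2 fun _ _ => h2 _, fun i => ?_⟩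
  have h3 : r i * ∏ j ∈ Finset.range i.val, r j = ∏ j ∈ Finset.range (i.val + 1), r j := by
    rw [Finset.prod_range_succ, ZMod.natCast_zmod_val, mul_comm]
  beta_reduce
  rw [h3]
  rcases (Nat.succ_le_of_lt (ZMod.val_lt i)).lt_or_eq with h | h
  · have : ((i + 1 : ZMod m)).val = i.val + 1 := by
      conv_lhs => rw [← ZMod.natCast_zmod_val i, ← Nat.cast_succ]
      exact ZMod.val_cast_of_lt h
    rw [this]
  · have : i + 1 = 0 := by
      rw [← ZMod.natCast_zmod_val i, ← Nat.cast_succ, h, ZMod.natCast_self]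
    rw [this, ZMod.val_zero]
    have h4 := prod_range_natCast r 0
    simp only [zero_add] at h4
    rw [show i.val + 1 = m from h, h4, hr]
    simp

theorem gE_e_mem (v : Option (ZMod m)) : gE k m q (.e v) ∈ HboxA k m q 0 :=
  Submodule.subset_span ⟨v, [], rfl, by simp⟩

theorem one_mem_HboxA : (1 : EΓ k m q) ∈ HboxA k m q 0 := by
  rw [← sum_e]
  exact sum_mem fun v _ => gE_e_mem q v

theorem e_mul_mem {l : ℕ} {z : EΓ k m q} (hz : z ∈ HboxA k m q l) (v : Option (ZMod m)) :
    gE k m q (.e v) * z ∈ HboxA k m q l := by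
  induction hz using Submodule.span_induction with
  | mem x hx =>
    obtain ⟨v', L, hL, rfl⟩ := hx
    rw [← mul_assoc, e_mul_e]
    split_ifs with h
    · exact Submodule.subset_span ⟨v, L, hL, by rw [h]⟩
    · simp
  | zero => simp
  | add x y _ _ hx hy => rw [mul_add]; exact add_mem hx hy
  | smul r x _ hx => rw [mul_smul_comm]; exact Submodule.smul_mem _ _ hx

theorem arrow_mul_mem {l : ℕ} {z : EΓ k m q} (hz : z ∈ HboxA k m q l) (a : ZMod m × Fin 3) :
    gE k m q (arrA m a) * z ∈ HboxA k m q (l + 1) := by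
  obtain ⟨v, w, h1, h2⟩ : ∃ v w : Option (ZMod m),
      gE k m q (arrA m a) = gE k m q (.e v) * gE k m q (arrA m a) ∧
      gE k m q (arrA m a) = gE k m q (arrA m a) * gE k m q (.e w) := by
    unfold arrA
    split_ifs
    · exact ⟨_, _, (e_mul_a_self q _).symm, (a_mul_e_self q _).symm⟩
    · exact ⟨_, _, (e_mul_b_self q _).symm, (b_mul_e_self q _).symm⟩
    · exact ⟨_, _, (e_mul_c_self q _).symm, (c_mul_e_self q _).symm⟩
  induction hz using Submodule.span_induction with
  | mem x hx =>
    obtain ⟨v', L, hL, rfl⟩ := hx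
    rw [h2, mul_assoc, ← mul_assoc (gE k m q (.e w)), e_mul_e]
    split_ifs with h
    · rw [← mul_assoc, ← h2, h1, mul_assoc]
      exact Submodule.subset_span ⟨v, a :: L, by simp [hL], by simp⟩
    · simp
  | zero => simp
  | add x y _ _ hx hy => rw [mul_add]; exact add_mem hx hy
  | smul r x _ hx => rw [mul_smul_comm]; exact Submodule.smul_mem _ _ hx

theorem sumA_mul_mem {l : ℕ} {z : EΓ k m q} (hz : z ∈ HboxA k m q l) :
    sumA q * z ∈ HboxA k m q (l + 1) := by
  rw [sumA, Finset.sum_mul]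
  exact sum_mem fun i _ => arrow_mul_mem q hz (i, 0)

theorem sumB_mul_mem {l : ℕ} {z : EΓ k m q} (hz : z ∈ HboxA k m q l) :
    sumB q * z ∈ HboxA k m q (l + 1) := by
  rw [sumB, Finset.sum_mul]
  exact sum_mem fun i _ => arrow_mul_mem q hz (i, 1)

theorem sumC_mul_mem {l : ℕ} {z : EΓ k m q} (hz : z ∈ HboxA k m q l) :
    sumC q * z ∈ HboxA k m q (l + 1) := by
  rw [sumC, Finset.sum_mul]
  exact sum_mem fun i _ => arrow_mul_mem q hz (i, 2)

theorem bimon_mem (f : ZMod m → k) (s t : ℕ) : bimon q f s t ∈ HboxA k m q (s + t) := by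
  have hB : sumB q ^ t ∈ HboxA k m q t := by
    induction t with
    | zero => simpa using one_mem_HboxA q
    | succ t ih => rw [pow_succ']; exact sumB_mul_mem q ih
  have hA : sumA q ^ s * sumB q ^ t ∈ HboxA k m q (s + t) := by
    induction s with
    | zero => simpa using hB
    | succ s ih =>
      rw [pow_succ', mul_assoc, add_right_comm]
      exact sumA_mul_mem q ih
  rw [bimon, mul_assoc, diag, Finset.sum_mul]
  refine sum_mem fun i _ => ?_
  rw [smul_mul_assoc]
  exact Submodule.smul_mem _ _ (e_mul_mem q hA _)

theorem central_of_commute {z : EΓ k m q} (he : ∀ v, Commute z (gE k m q (.e v)))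
    (hA : Commute z (sumA q)) (hB : Commute z (sumB q)) (hC : Commute z (sumC q))
    (y : EΓ k m q) : Commute z y := by
  induction y using gE_induction with
  | algebraMap r => exact (Algebra.commutes r z).symm
  | gen g =>
    cases g with
    | e v => exact he v
    | a i => rw [← e_mul_sumA]; exact (he _).mul_right hA
    | b i => rw [← e_mul_sumB]; exact (he _).mul_right hB
    | c i => rw [← e_mul_sumC]; exact (he _).mul_right hC
  | mul x y hx hy => exact hx.mul_right hy
  | add x y hx hy => exact hx.add_right hy

/-- The length-homogeneous elements of length `l` in the graded centre. -/
def GradedCentral (l : ℕ) (z : EΓ k m q) : Prop :=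
  z ∈ HboxA k m q l ∧ ∀ (l' : ℕ) (y : EΓ k m q), y ∈ HboxA k m q l' →
    z * y = ((-1 : k) ^ (l * l')) • (y * z)

section Coordinates

variable {q} {l : ℕ} {z : EΓ k m q} (hz : GradedCentral q l z)
include hz

theorem GradedCentral.co_c (i : ZMod m) (s : ℕ) : co q z (.c i s) = 0 := by
  have h := hz.2 0 _ (gE_e_mem q none)
  rw [mul_zero, pow_zero, one_smul] at h
  rw [← co_mul_e_none_c, h, co_mul, ρ_e_apply]
  simp [NF.src]

theorem GradedCentral.sumA_comm : z * sumA q = (-1 : k) ^ l • (sumA q * z) := by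
  simpa using hz.2 1 _ (sumA_mul_mem q (one_mem_HboxA q))

theorem GradedCentral.sumB_comm : z * sumB q = (-1 : k) ^ l • (sumB q * z) := by
  simpa using hz.2 1 _ (sumB_mul_mem q (one_mem_HboxA q))

theorem GradedCentral.sumC_comm : z * sumC q = (-1 : k) ^ l • (sumC q * z) := by
  simpa using hz.2 1 _ (sumC_mul_mem q (one_mem_HboxA q))

theorem GradedCentral.co_p_zero (i : ZMod m) (s : ℕ) :
    co q z (.p i s 0) = if s = 0 then (-1) ^ l * co q z .o else 0 := by
  rw [← co_mul_sumC_c, hz.sumC_comm, map_smul, Finsupp.smul_apply, co_mul, ρ_sumC_apply]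
  simp

theorem GradedCentral.natCast_eq {i : ZMod m} {s t : ℕ} (h : co q z (.p i s t) ≠ 0) :
    (s : ZMod m) = t := by
  have h1 := hz.2 0 _ (gE_e_mem q (some i))
  rw [mul_zero, pow_zero, one_smul] at h1
  have h2 := congrArg (fun x => co q x (.p i s t)) h1
  beta_reduce at h2
  rw [co_mul_e_p, co_mul, ρ_e_apply] at h2
  simp only [NF.src, if_true] at h2
  by_contra h3
  rw [if_neg] at h2
  · exact h h2.symm
  · intro h4
    rw [add_sub_assoc, add_eq_left, sub_eq_zero] at h4
    exact h3 h4

theorem GradedCentral.rec_A (s t : ℕ) (i : ZMod m) :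
    co q z (.p (i + 1) s t) = (-1) ^ l * κ q i t * co q z (.p i s t) := by
  have h := congrArg (fun x => co q x (.p i (s + 1) t)) hz.sumA_comm
  beta_reduce at h
  rw [co_mul_sumA_p, map_smul, Finsupp.smul_apply, co_mul, ρ_sumA_apply] at h
  simp only [K_one_right, smul_eq_mul] at h
  have h1 : (-1 : k) ^ l * (-1) ^ l = 1 := by rw [← mul_pow]; simp
  have h2 : co q z (.p (i + 1) s t) =
      (-1) ^ l * (κ q (i + (s : ZMod m) - (t : ZMod m)) t * co q z (.p i s t)) := by
    rw [h, ← mul_assoc, h1, one_mul]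
  rw [h2, mul_assoc]
  by_cases h3 : co q z (.p i s t) = 0
  · simp [h3]
  · rw [hz.natCast_eq h3, add_sub_cancel_right]

theorem GradedCentral.rec_B (s t : ℕ) (i : ZMod m) :
    co q z (.p (i + 1) s t) = (-1) ^ l * κ q i s * co q z (.p i s t) := by
  have h := congrArg (fun x => co q x (.p (i + 1) s (t + 1))) hz.sumB_comm
  beta_reduce at h
  rw [co_mul_sumB_p, map_smul, Finsupp.smul_apply, co_mul, ρ_sumB_apply] at h
  simp only [smul_eq_mul] at h
  rw [h, mul_assoc]

theorem GradedCentral.eq_smul_one (hl : l = 0) : z = co q z .o • 1 := by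
  apply co_injective
  have h1 : co q (1 : EΓ k m q) = unitVec := by simp [co_apply]
  rw [map_smul, h1]
  ext n
  classical
  by_cases hn : n.deg = 0
  · cases n with
    | p i s t =>
      obtain ⟨rfl, rfl⟩ : s = 0 ∧ t = 0 := by simpa [NF.deg] using hn
      rw [hz.co_p_zero, Finsupp.smul_apply, unitVec, Finsupp.add_apply, Finsupp.finsetSum_apply,
        Finset.sum_eq_single i] <;> simp +contextual [hl]
    | c i s => simp [NF.deg] at hn
    | o => simp [unitVec]
  · have h2 : co q z n = 0 := by
      by_contra h
      exact hn (hl ▸ deg_of_mem q hz.1 h)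
    have h3 : co q (1 : EΓ k m q) n = 0 := by
      by_contra h
      exact hn (deg_of_mem q (one_mem_HboxA q) h)
    rw [h2, ← h1, Finsupp.smul_apply, h3, smul_zero]

theorem GradedCentral.eq_sum (hl : 0 < l) :
    z = ∑ s ∈ Finset.range (l + 1), bimon q (fun i => co q z (.p i s (l - s))) s (l - s) := by
  classical
  apply co_injective
  rw [map_sum]
  ext n
  rw [Finsupp.finsetSum_apply]
  cases n with
  | p i s t =>
    simp only [co_bimon_p]
    by_cases h : s + t = l
    · rw [Finset.sum_eq_single s]
      · rw [if_pos ⟨rfl, by omega⟩, show l - s = t by omega]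
      · intro s' _ hs'
        rw [if_neg (fun h => hs' h.1)]
      · intro hs
        exact absurd (Finset.mem_range.2 (by omega)) hs
    · rw [Finset.sum_eq_zero]
      · by_contra h'
        exact h (deg_of_mem q hz.1 h')
      · intro s' hs'
        rw [Finset.mem_range] at hs'
        rw [if_neg (by omega)]
  | c i s => simp [co_bimon_c, hz.co_c]
  | o =>
    simp only [co_bimon_o, Finset.sum_const_zero]
    by_contra h'
    exact hl.ne (deg_of_mem q hz.1 h')

end Coordinates

theorem bimon_injective (s t : ℕ) : Function.Injective fun f => bimon q f s t := by
  intro f g h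
  ext i
  simpa [co_bimon_p] using congrArg (fun x => co q x (.p i s t)) h

theorem bimon_smul (r : k) (f : ZMod m → k) (s t : ℕ) :
    bimon q (r • f) s t = r • bimon q f s t := by
  simp only [bimon, diag, Pi.smul_apply, smul_eq_mul, mul_smul]
  rw [← Finset.smul_sum, smul_mul_assoc, smul_mul_assoc]

theorem bimon_mul_diag_one (f : ZMod m → k) (s t : ℕ) :
    bimon q f s t * diag q 1 = bimon q f s t := by
  simpa [mul_add, bimon_mul_e_none] using congrArg (bimon q f s t * ·) (diag_one_add q)

theorem commute_bimon_e (f : ZMod m → k) {s t : ℕ} (h : (s : ZMod m) = t) (i : ZMod m) :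
    Commute (bimon q f s t) (gE k m q (.e (some i))) := by
  rw [e_eq_bimon, Commute, SemiconjBy, bimon_mul_bimon, bimon_mul_bimon]
  simp [h, K_zero_left, K_zero_right, mul_comm]

theorem commute_bimon_sumA_iff (f : ZMod m → k) {s t : ℕ} (h : (s : ZMod m) = t) :
    Commute (bimon q f s t) (sumA q) ↔ ∀ i, f (i + 1) = κ q i t * f i := by
  rw [sumA_eq_bimon, Commute, SemiconjBy, bimon_mul_bimon, bimon_mul_bimon, add_comm s 1,
    add_comm t 0, (bimon_injective q _ _).eq_iff, funext_iff]
  refine forall_congr' fun i => ?_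
  rw [eq_comm]
  simp [h, K_zero_left, K_one_right, mul_comm]

theorem commute_bimon_sumB_iff (f : ZMod m → k) {s t : ℕ} (h : (s : ZMod m) = t) :
    Commute (bimon q f s t) (sumB q) ↔ ∀ i, f (i + 1) = κ q i s * f i := by
  rw [sumB_eq_bimon, Commute, SemiconjBy, bimon_mul_bimon, bimon_mul_bimon, add_comm s 0,
    add_comm t 1, (bimon_injective q _ _).eq_iff, funext_iff,
    ← (Equiv.addRight (1 : ZMod m)).forall_congr_right]
  refine forall_congr' fun i => ?_
  simp [h, K_zero_right, K_one_left]

/-- `z` is a bihomogeneous element of bidegree `(s, t)`, supported at every vertex but the extra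
one, that commutes with every path avoiding the extra vertex. -/
structure IsBicentral (z : EΓ k m q) (s t : ℕ) : Prop where
  exists_eq : ∃ f : ZMod m → k, (∀ i, f i ≠ 0) ∧ z = bimon q f s t
  cast_eq : (s : ZMod m) = t
  commute_sumA : Commute z (sumA q)
  commute_sumB : Commute z (sumB q)

theorem isBicentral_bimon {f : ZMod m → k} (hf : ∀ i, f i ≠ 0) {s t : ℕ} (h : (s : ZMod m) = t)
    (ht : ∀ i, f (i + 1) = κ q i t * f i) (hs : ∀ i, f (i + 1) = κ q i s * f i) :
    IsBicentral q (bimon q f s t) s t :=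
  ⟨⟨f, hf, rfl⟩, h, (commute_bimon_sumA_iff q f h).2 ht, (commute_bimon_sumB_iff q f h).2 hs⟩

theorem isBicentral_diag_one : IsBicentral q (diag q 1) 0 0 := by
  have h := isBicentral_bimon q (f := 1) (s := 0) (t := 0) (by simp) rfl (by simp [κ_zero])
    (by simp [κ_zero])
  simpa [bimon] using h

section IsBicentral

variable {q} {z z' : EΓ k m q} {s t s' t' : ℕ}

theorem IsBicentral.commute_e (h : IsBicentral q z s t) (i : ZMod m) :
    Commute z (gE k m q (.e (some i))) := by
  obtain ⟨f, -, rfl⟩ := h.exists_eq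
  exact commute_bimon_e q f h.cast_eq i

theorem IsBicentral.commute (h : IsBicentral q z s t) (h' : IsBicentral q z' s' t') :
    Commute z z' := by
  obtain ⟨f, -, rfl⟩ := h'.exists_eq
  refine .mul_right (.mul_right ?_ (h.commute_sumA.pow_right _)) (h.commute_sumB.pow_right _)
  exact .sum_right _ _ _ fun i _ => (h.commute_e i).smul_right _

theorem IsBicentral.mul (hq : ∀ i, q i ≠ 0) (h : IsBicentral q z s t)
    (h' : IsBicentral q z' s' t') : IsBicentral q (z * z') (s + s') (t + t') where
  exists_eq := by
    obtain ⟨f, hf, rfl⟩ := h.exists_eq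
    obtain ⟨g, hg, rfl⟩ := h'.exists_eq
    exact ⟨_, fun i => mul_ne_zero (mul_ne_zero (hf _) (K_ne_zero hq _ _ _)) (hg _),
      bimon_mul_bimon q f g s t s' t'⟩
  cast_eq := by rw [Nat.cast_add, Nat.cast_add, h.cast_eq, h'.cast_eq]
  commute_sumA := h.commute_sumA.mul_left h'.commute_sumA
  commute_sumB := h.commute_sumB.mul_left h'.commute_sumB

theorem IsBicentral.smul {r : k} (hr : r ≠ 0) (h : IsBicentral q z s t) :
    IsBicentral q (r • z) s t where
  exists_eq := by
    obtain ⟨f, hf, rfl⟩ := h.exists_eq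
    exact ⟨r • f, fun i => mul_ne_zero hr (hf i), (bimon_smul q r f s t).symm⟩
  cast_eq := h.cast_eq
  commute_sumA := h.commute_sumA.smul_left r
  commute_sumB := h.commute_sumB.smul_left r

theorem IsBicentral.pow_mul (hq : ∀ i, q i ≠ 0) (h : IsBicentral q z s t)
    (h' : IsBicentral q z' s' t') (n : ℕ) :
    IsBicentral q (z ^ n * z') (n * s + s') (n * t + t') := by
  induction n with
  | zero => simpa using h'
  | succ n ih =>
    rw [pow_succ', mul_assoc, show (n + 1) * s + s' = s + (n * s + s') by ring,
      show (n + 1) * t + t' = t + (n * t + t') by ring]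
    exact h.mul hq ih

theorem IsBicentral.mul_diag_one (h : IsBicentral q z s t) : z * diag q 1 = z := by
  obtain ⟨f, -, rfl⟩ := h.exists_eq
  exact bimon_mul_diag_one q f s t

theorem IsBicentral.co_ne_zero (h : IsBicentral q z s t) : co q z (.p 0 s t) ≠ 0 := by
  obtain ⟨f, hf, rfl⟩ := h.exists_eq
  simpa [co_bimon_p] using hf 0

theorem IsBicentral.co_eq_zero (h : IsBicentral q z s t) (h' : ¬(s = s' ∧ t = t')) :
    co q z (.p 0 s' t') = 0 := by
  obtain ⟨f, -, rfl⟩ := h.exists_eq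
  rw [co_bimon_p, if_neg h']

/-- Bihomogeneous elements satisfying the same commutation relation with `sumA` as a given
bicentral element are multiples of it. -/
theorem IsBicentral.bimon_eq_smul (h : IsBicentral q z s t) {f : ZMod m → k}
    (hf : ∀ i, f (i + 1) = κ q i t * f i) : ∃ r : k, bimon q f s t = r • z := by
  have hA := h.commute_sumA
  obtain ⟨g, hg, rfl⟩ := h.exists_eq
  rw [commute_bimon_sumA_iff q g h.cast_eq] at hA
  exact ⟨_, by rw [← bimon_smul, ← eq_smul_of_rec hf hA (hg 0)]⟩

theorem IsBicentral.eq_smul (h : IsBicentral q z s t) (h' : IsBicentral q z' s t) :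
    ∃ r : k, r ≠ 0 ∧ z' = r • z := by
  have hA := h'.commute_sumA
  have h0 := h'.co_ne_zero
  obtain ⟨g, hg, rfl⟩ := h'.exists_eq
  rw [commute_bimon_sumA_iff q g h.cast_eq] at hA
  obtain ⟨r, hr⟩ := h.bimon_eq_smul hA
  refine ⟨r, ?_, hr⟩
  rintro rfl
  simp [hr] at h0

theorem IsBicentral.gradedCentral (h : IsBicentral q z s t) (ht : 0 < t)
    (hst : (-1 : k) ^ (s + t) = 1) : GradedCentral q (s + t) z := by
  have h1 := h.commute_e
  have hA := h.commute_sumA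
  have hB := h.commute_sumB
  obtain ⟨f, -, rfl⟩ := h.exists_eq
  refine ⟨bimon_mem q f s t, fun l' y _ => ?_⟩
  rw [_root_.pow_mul, hst, one_pow, one_smul]
  refine central_of_commute q ?_ hA hB ?_ y
  · rintro (_ | i)
    · rw [Commute, SemiconjBy, e_none_mul_bimon, bimon_mul_e_none]
    · exact h1 i
  · rw [Commute, SemiconjBy, sumC_mul_bimon, bimon_mul_sumC q f s ht]

end IsBicentral
/-- The algebra homomorphism out of `k[x,y,w]/⟨w^p - ε x y⟩` given by commuting elements. -/
theorem exists_algHom_quotP {E : Type*} [Ring E] [Algebra k E] {p : ℕ} {ε : k} {x y w : E}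
    (hxy : Commute x y) (hxw : Commute x w) (hyw : Commute y w) (h : w ^ p = ε • (x * y)) :
    ∃ φ : QuotP k p ε →ₐ[k] E, ∀ i j l : ℕ,
      φ (Ideal.Quotient.mk _ ((X 0 : MvPolynomial (Fin 3) k) ^ i * X 1 ^ j * X 2 ^ l)) =
        x ^ i * y ^ j * w ^ l := by
  let F : Multiplicative (Fin 3 →₀ ℕ) →* E :=
    { toFun := fun n => x ^ n.toAdd 0 * y ^ n.toAdd 1 * w ^ n.toAdd 2
      map_one' := by simp
      map_mul' := fun a b => by
        simp only [toAdd_mul, Finsupp.add_apply, pow_add]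
        generalize a.toAdd 0 = a0, a.toAdd 1 = a1, a.toAdd 2 = a2, b.toAdd 0 = b0,
          b.toAdd 1 = b1, b.toAdd 2 = b2
        rw [mul_assoc (x ^ a0 * y ^ a1) (w ^ a2), ← mul_assoc (w ^ a2) (x ^ b0 * y ^ b1),
          (((hxw.pow_pow b0 a2).mul_left (hyw.pow_pow b1 a2)).eq).symm,
          mul_assoc (x ^ a0) (y ^ a1), ← mul_assoc (y ^ a1), ← mul_assoc (y ^ a1),
          ← mul_assoc (y ^ a1), (hxy.pow_pow b0 a1).eq.symm]
        simp only [mul_assoc] }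
  let φ₀ : MvPolynomial (Fin 3) k →ₐ[k] E := AddMonoidAlgebra.lift k E (Fin 3 →₀ ℕ) F
  have hX (n : Fin 3) : φ₀ (X n) = F (Multiplicative.ofAdd (Finsupp.single n 1)) :=
    (AddMonoidAlgebra.lift_single F _ _).trans (one_smul _ _)
  have h0 : φ₀ (X 0) = x := by simp [hX, F]
  have h1 : φ₀ (X 1) = y := by simp [hX, F]
  have h2 : φ₀ (X 2) = w := by simp [hX, F]
  have hI : ∀ a ∈ Ideal.span {(X 2 : MvPolynomial (Fin 3) k) ^ p - C ε * X 0 * X 1},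
      φ₀ a = 0 := by
    intro a ha
    obtain ⟨b, rfl⟩ := Ideal.mem_span_singleton'.1 ha
    rw [map_mul, map_sub, map_mul, map_mul, map_pow, h0, h1, h2, ← algebraMap_eq, AlgHom.commutes,
      h, Algebra.smul_def, mul_assoc, sub_self, mul_zero]
  refine ⟨Ideal.Quotient.liftₐ _ φ₀ hI, fun i j l => ?_⟩
  change φ₀ _ = _
  rw [map_mul, map_mul, map_pow, map_pow, map_pow, h0, h1, h2]

/-- The monomials with `w`-exponent less than `p` span `k[x,y,w]/⟨w^p - ε x y⟩`. -/
theorem span_quotP {p : ℕ} (hp : 0 < p) (ε : k) :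
    Submodule.span k (Set.range fun n : ℕ × ℕ × Fin p => (Ideal.Quotient.mk _
      ((X 0 : MvPolynomial (Fin 3) k) ^ n.1 * X 1 ^ n.2.1 * X 2 ^ (n.2.2 : ℕ)) : QuotP k p ε)) =
      ⊤ := by
  rw [eq_top_iff]
  set S := Submodule.span k (Set.range fun n : ℕ × ℕ × Fin p => (Ideal.Quotient.mk _
      ((X 0 : MvPolynomial (Fin 3) k) ^ n.1 * X 1 ^ n.2.1 * X 2 ^ (n.2.2 : ℕ)) : QuotP k p ε))
    with hS
  have key : ∀ l i j : ℕ, (Ideal.Quotient.mk _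
      ((X 0 : MvPolynomial (Fin 3) k) ^ i * X 1 ^ j * X 2 ^ l) : QuotP k p ε) ∈ S := by
    intro l
    induction l using Nat.strong_induction_on with
    | _ l ih =>
      intro i j
      by_cases hl : l < p
      · exact Submodule.subset_span ⟨(i, j, ⟨l, hl⟩), rfl⟩
      · have h : (Ideal.Quotient.mk _
            ((X 0 : MvPolynomial (Fin 3) k) ^ i * X 1 ^ j * X 2 ^ l) : QuotP k p ε) =
            ε • Ideal.Quotient.mk _
              ((X 0 : MvPolynomial (Fin 3) k) ^ (i + 1) * X 1 ^ (j + 1) * X 2 ^ (l - p)) := by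
          rw [← Ideal.Quotient.mkₐ_eq_mk k, ← map_smul, Ideal.Quotient.mkₐ_eq_mk,
            Ideal.Quotient.eq, Ideal.mem_span_singleton']
          refine ⟨X 0 ^ i * X 1 ^ j * X 2 ^ (l - p), ?_⟩
          obtain ⟨r, rfl⟩ := Nat.exists_eq_add_of_le (not_lt.1 hl)
          rw [Nat.add_sub_cancel_left, smul_eq_C_mul]
          ring
        rw [h]
        exact Submodule.smul_mem _ _ (ih _ (by omega) _ _)
  rintro a -
  obtain ⟨P, rfl⟩ := Ideal.Quotient.mk_surjective a
  induction P using MvPolynomial.induction_on' with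
  | monomial u r =>
    have h : (monomial u r : MvPolynomial (Fin 3) k) =
        r • (X 0 ^ u 0 * X 1 ^ u 1 * X 2 ^ u 2) := by
      rw [monomial_eq, smul_eq_C_mul, Finsupp.prod_fintype _ _ (by simp), Fin.prod_univ_three]
    rw [h, ← Ideal.Quotient.mkₐ_eq_mk k, map_smul]
    exact Submodule.smul_mem _ _ (key _ _ _)
  | add P Q hP hQ => rw [map_add]; exact add_mem hP hQ

/-- A linear map is injective as soon as it sends a spanning family to a family which is
separated by linear functionals. -/
theorem injective_of_separated {ι V W : Type*} [AddCommGroup V] [Module k V] [AddCommMonoid W]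
    [Module k W] {b : ι → V} (hb : Submodule.span k (Set.range b) = ⊤) (φ : V →ₗ[k] W)
    (χ : ι → W →ₗ[k] k) (h1 : ∀ i, χ i (φ (b i)) ≠ 0)
    (h2 : ∀ i j, i ≠ j → χ i (φ (b j)) = 0) : Function.Injective φ := by
  classical
  rw [injective_iff_map_eq_zero]
  intro v hv
  obtain ⟨c, rfl⟩ := Finsupp.mem_span_range_iff_exists_finsupp.1
    (hb ▸ Submodule.mem_top : v ∈ Submodule.span k (Set.range b))
  suffices c = 0 by simp [this]
  ext i
  have h := congrArg (χ i) hv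
  rw [Finsupp.sum, map_sum, map_sum, map_zero, Finset.sum_eq_single i] at h
  · simpa [h1] using h
  · intro j _ hj
    rw [map_smul, map_smul, h2 i j hj.symm, smul_zero]
  · intro hi
    rw [Finsupp.notMem_support_iff.1 hi, zero_smul, map_zero, map_zero]
section MainIso

variable {q}

/-- The exponents of `w ^ p = ε x y` are separated by the bidegree. -/
theorem bidegree_injective {D p : ℕ} (hD : 0 < D) {i j i' j' : ℕ} {l l' : Fin p}
    (hs : D * (p * i + l) = D * (p * i' + l')) (ht : D * (p * j + l) = D * (p * j' + l')) :
    i = i' ∧ j = j' ∧ l = l' := by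
  have hs' := Nat.eq_of_mul_eq_mul_left hD hs
  have ht' := Nat.eq_of_mul_eq_mul_left hD ht
  have hp : 0 < p := l.pos
  have h1 := congrArg (· % p) hs'
  have h2 := congrArg (· / p) hs'
  have h3 := congrArg (· / p) ht'
  simp only [Nat.mul_add_mod, Nat.mod_eq_of_lt l.2, Nat.mod_eq_of_lt l'.2] at h1
  simp only [Nat.mul_add_div hp, Nat.div_eq_of_lt l.2, Nat.div_eq_of_lt l'.2, add_zero] at h2 h3
  exact ⟨h2, h3, Fin.ext h1⟩

/-- The bidegrees supporting the graded centre. -/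
theorem GradedCentral.exists_exponents (hq : ∀ i, q i ≠ 0) {D c : ℕ}
    (h4 : ∀ u t : ℕ, hol q ^ u = 1 → hol q ^ t = (-1) ^ (m * u) → D ∣ t ∧ D * c ∣ u)
    {l s t : ℕ} (hst : s + t = l) {z : EΓ k m q} (hz : GradedCentral q l z) {i : ZMod m}
    (hi : co q z (.p i s t) ≠ 0) :
    ∃ a b j : ℕ, s = D * (m * c * a + b) ∧ t = D * (m * c * j + b) := by
  have hA := hz.rec_A s t
  have hB := hz.rec_B s t
  have hκ : κ q i t = κ q i s := by
    have h := (hA i).symm.trans (hB i)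
    exact mul_left_cancel₀ (pow_ne_zero l (neg_ne_zero.2 one_ne_zero)) (mul_right_cancel₀ hi h)
  have hAp := prod_eq_one_of_rec (f := fun i => co q z (.p i s t)) hA hi
  have hBp := prod_eq_one_of_rec (f := fun i => co q z (.p i s t)) hB hi
  rw [Finset.prod_mul_distrib, prod_κ, Finset.prod_const, Finset.card_univ, ZMod.card, ← pow_mul]
    at hAp hBp
  have main : ∀ s t : ℕ, t ≤ s → s + t = l → (s : ZMod m) = t → κ q i t = κ q i s →
      (-1 : k) ^ (l * m) * hol q ^ t = 1 → ∃ a b : ℕ, s = D * (m * c * a + b) ∧ t = D * b := by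
    clear hst hi hA hB hκ hAp hBp
    intro s t hts hl hcast hκ hp
    have hdvd : m ∣ s - t := by
      rw [← ZMod.natCast_eq_zero_iff, Nat.cast_sub hts, hcast, sub_self]
    obtain ⟨u, hu⟩ := hdvd
    obtain rfl : s = t + m * u := by omega
    rw [κ_add, κ_mul, eq_comm, mul_eq_left₀ (κ_ne_zero hq i t)] at hκ
    have h1 : (-1 : k) ^ (l * m) = (-1) ^ (m * u) := by
      rw [← hl, show (t + m * u + t) * m = 2 * (t * m) + m * (m * u) by ring, pow_add, pow_mul]
      rcases Nat.even_or_odd m with h | h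
      · rw [(h.mul_right _).neg_one_pow, (h.mul_right _).neg_one_pow]
        simp
      · rw [pow_mul (-1 : k) m, h.neg_one_pow]
        simp
    rw [h1] at hp
    have h2 : hol q ^ t = (-1) ^ (m * u) := by
      have h3 : (-1 : k) ^ (m * u) * (-1) ^ (m * u) = 1 := by rw [← mul_pow]; simp
      calc hol q ^ t = (-1) ^ (m * u) * ((-1) ^ (m * u) * hol q ^ t) := by
            rw [← mul_assoc, h3, one_mul]
        _ = _ := by rw [hp, mul_one]
    obtain ⟨⟨b, rfl⟩, ⟨a, rfl⟩⟩ := h4 u t hκ h2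
    exact ⟨a, b, by ring, rfl⟩
  rcases le_total t s with h | h
  · obtain ⟨a, b, h1, h2⟩ := main s t h hst (hz.natCast_eq hi) hκ hAp
    exact ⟨a, b, 0, h1, by simpa using h2⟩
  · obtain ⟨a, b, h1, h2⟩ := main t s h (by omega) (hz.natCast_eq hi).symm hκ.symm hBp
    exact ⟨0, b, a, by simpa using h2, h1⟩

/-- The graded centre is `(k[x,y,w]/⟨w^p - ε x y⟩)_{x*}` as soon as the numerical condition
describing its bidegrees holds. -/
theorem nonempty_algEquiv (hq : ∀ i, q i ≠ 0) {D c p : ℕ} (hD : 0 < D) (hc : 0 < c)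
    (hp : p = m * c) (hDhol : hol q ^ D = 1) (hsign : (-1 : k) ^ (D * p) = 1)
    (h4 : ∀ u t : ℕ, hol q ^ u = 1 → hol q ^ t = (-1) ^ (m * u) → D ∣ t ∧ D * c ∣ u)
    {ε : k} (hε : ε ≠ 0) : Nonempty (ZgrA k m q ≃ₐ[k] AstarP k p ε) := by
  have hp0 : 0 < p := hp ▸ Nat.mul_pos (NeZero.pos m) hc
  have hDp : D * p = m * (c * D) := by rw [hp]; ring
  have hcast : ((D * p : ℕ) : ZMod m) = 0 := by rw [hDp]; simp
  have hκ (i : ZMod m) : κ q i (D * p) = 1 := by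
    rw [hDp, κ_mul, mul_comm, pow_mul, hDhol, one_pow]
  obtain ⟨g, hg0, hg⟩ := exists_rec (r := fun i => κ q i D) (by rw [prod_κ, hDhol])
  have hx₀ : IsBicentral q (bimon q 1 (D * p) 0) (D * p) 0 :=
    isBicentral_bimon q (by simp) (by simpa using hcast) (by simp [κ_zero]) (by simp [hκ])
  have hy : IsBicentral q (bimon q 1 0 (D * p)) 0 (D * p) :=
    isBicentral_bimon q (by simp) (by simpa using hcast.symm) (by simp [hκ]) (by simp [κ_zero])
  have hw : IsBicentral q (bimon q g D D) D D := isBicentral_bimon q hg0 rfl hg hg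
  set y := bimon q 1 0 (D * p)
  set w := bimon q g D D
  obtain ⟨r, hr0, hr⟩ : ∃ r : k, r ≠ 0 ∧ w ^ p = r • (bimon q 1 (D * p) 0 * y) := by
    refine IsBicentral.eq_smul (s := D * p) (t := D * p) ?_ ?_
    · simpa using hx₀.mul hq hy
    · have h := hw.pow_mul hq hw (p - 1)
      rw [← pow_succ, Nat.sub_add_cancel hp0, ← Nat.succ_mul, Nat.succ_eq_add_one,
        Nat.sub_add_cancel hp0, mul_comm p D] at h
      exact h
  have hx := hx₀.smul (div_ne_zero hr0 hε)
  set x := (r / ε) • bimon q 1 (D * p) 0 with hxdef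
  have hrel : w ^ p = ε • (x * y) := by
    rw [hxdef, smul_mul_assoc, smul_smul, mul_div_cancel₀ _ hε, hr]
  obtain ⟨φ, hφ⟩ := exists_algHom_quotP (hx.commute hy) (hx.commute hw) (hy.commute hw) hrel
  have hmon (i j l : ℕ) : IsBicentral q (x ^ i * y ^ j * w ^ l * diag q 1)
      (D * (p * i + l)) (D * (p * j + l)) := by
    have h := hx.pow_mul hq (hy.pow_mul hq (hw.pow_mul hq (isBicentral_diag_one q) l) j) i
    rw [← mul_assoc, ← mul_assoc] at h
    convert h using 1 <;> ring
  have hmon' (i j l : ℕ) (hjl : 0 < j + l) : IsBicentral q (x ^ i * y ^ j * w ^ l)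
      (D * (p * i + l)) (D * (p * j + l)) := by
    suffices h : x ^ i * y ^ j * w ^ l * diag q 1 = x ^ i * y ^ j * w ^ l by
      rw [← h]; exact hmon i j l
    rcases l with _ | l
    · rcases j with _ | j
      · omega
      · simp only [pow_zero, mul_one, pow_succ, mul_assoc, hy.mul_diag_one]
    · simp only [pow_succ, mul_assoc, hw.mul_diag_one]
  have hinj : Function.Injective φ := by
    refine injective_of_separated (span_quotP hp0 ε) φ.toLinearMap
      (fun n => Finsupp.lapply (.p 0 (D * (p * n.1 + n.2.2)) (D * (p * n.2.1 + n.2.2))) ∘ₗ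
        co q ∘ₗ LinearMap.mulRight k (diag q 1)) (fun n => ?_) fun n n' hn => ?_
    · simp only [AlgHom.toLinearMap_apply, hφ]
      exact (hmon n.1 n.2.1 n.2.2).co_ne_zero
    · simp only [AlgHom.toLinearMap_apply, hφ]
      refine (hmon n'.1 n'.2.1 n'.2.2).co_eq_zero fun h => hn ?_
      obtain ⟨h1, h2, h3⟩ := bidegree_injective hD h.1 h.2
      exact Prod.ext h1.symm (Prod.ext h2.symm h3.symm)
  have hpow (i j l : ℕ) : (-1 : k) ^ (D * (p * i + l) + D * (p * j + l)) = 1 := by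
    rw [show D * (p * i + l) + D * (p * j + l) = D * p * (i + j) + 2 * (D * l) by ring, pow_add,
      pow_mul, hsign, pow_mul (-1 : k) 2]
    simp
  have hmap : (AstarP k p ε).map φ = ZgrA k m q := by
    rw [AstarP, AlgHom.map_adjoin]
    refine le_antisymm (Algebra.adjoin_le ?_) (Algebra.adjoin_le ?_)
    · rintro _ ⟨_, ⟨i, j, l, hjl, rfl⟩, rfl⟩
      have hpos : 0 < D * (p * j + l) := by
        refine Nat.mul_pos hD ?_
        rcases Nat.eq_zero_or_pos l with rfl | hl
        · exact Nat.add_pos_left (Nat.mul_pos hp0 (by omega)) _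
        · omega
      rw [hφ]
      exact Algebra.subset_adjoin
        ⟨_, (hmon' i j l hjl).gradedCentral hpos (hpow i j l)⟩
    · rintro z ⟨l, hz⟩
      replace hz : GradedCentral q l z := hz
      rcases Nat.eq_zero_or_pos l with hl | hl
      · rw [hz.eq_smul_one hl]
        exact Subalgebra.smul_mem _ (one_mem _) _
      · rw [hz.eq_sum hl]
        refine sum_mem fun s hs => ?_
        rw [Finset.mem_range] at hs
        obtain ⟨t, ht⟩ : ∃ t, l - s = t := ⟨_, rfl⟩
        rw [ht]
        by_cases h0 : ∀ i, co q z (.p i s t) = 0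
        · simp [h0, bimon, diag]
        · obtain ⟨i, hi⟩ := not_forall.1 h0
          have ht0 : t ≠ 0 := by
            rintro rfl
            rw [hz.co_p_zero, if_neg (by omega)] at hi
            exact hi rfl
          have hA := hz.rec_A s t
          have hst : s + t = l := by omega
          obtain ⟨a, b, j, hs', ht'⟩ := hz.exists_exponents hq h4 hst hi
          rw [← hp] at hs' ht'
          have hl' : (-1 : k) ^ l = 1 := by rw [← hst, hs', ht', hpow]
          simp only [hl', one_mul] at hA
          rw [ht'] at ht0
          rw [hs', ht'] at hA ⊢
          have hjb : 0 < j + b := by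
            rcases Nat.eq_zero_or_pos (j + b) with h | h
            · obtain ⟨rfl, rfl⟩ : j = 0 ∧ b = 0 := by omega
              simp at ht0
            · exact h
          obtain ⟨r', hr'⟩ := (hmon' a j b hjb).bimon_eq_smul
            (f := fun i => co q z (.p i (D * (p * a + b)) (D * (p * j + b)))) hA
          rw [hr', ← hφ]
          refine Subalgebra.smul_mem _ (Algebra.subset_adjoin ?_) _
          exact Set.mem_image_of_mem φ ⟨a, j, b, hjb, rfl⟩
  exact ⟨((Subalgebra.equivMapOfInjective _ φ hinj).trans (Subalgebra.equivOfEq _ _ hmap)).symm⟩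

end MainIso
theorem hol_eq : hol q = (-1) ^ m * (∏ i, q i)⁻¹ := by
  simp [hol, Finset.prod_neg, ZMod.card]

theorem qprod_ne_zero {q : ZMod m → k} (hq : ∀ i, q i ≠ 0) (k' c : ℕ) : qprod k m q k' c ≠ 0 :=
  Finset.prod_ne_zero_iff.2 fun _ _ => hq _

theorem prod_inv_qprod_ne_zero {q : ZMod m → k} (hq : ∀ i, q i ≠ 0) (S : Finset ℕ)
    (T : ℕ → Finset ℕ) (c : ℕ) : ∏ l ∈ S, ∏ k' ∈ T l, (qprod k m q k' c)⁻¹ ≠ 0 :=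
  Finset.prod_ne_zero_iff.2 fun _ _ => Finset.prod_ne_zero_iff.2 fun _ _ =>
    inv_ne_zero (qprod_ne_zero hq _ _)

theorem even_of_neg_one_pow_eq_one (h : ringChar k ≠ 2) {n : ℕ} (hn : (-1 : k) ^ n = 1) :
    Even n := by
  by_contra h'
  rw [(Nat.not_even_iff_odd.1 h').neg_one_pow] at hn
  exact Ring.neg_one_ne_one_of_char_ne_two h hn

end KoszulDual

/-- Proposition 2.3.  Suppose `ζ = q₀ ⋯ q_{m−1}` is a primitive `d`-th root
of unity in `k`.  Then `Z_gr(E(Γ_q)) ≅ (k[x,y,w]/⟨w^{2m} − ε_d x y⟩)_{x*}` if `m` is odd,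
`char k ≠ 2` and `d ≡ 2 (mod 4)`, and `Z_gr(E(Γ_q)) ≅ (k[x,y,w]/⟨w^m − ε_d x y⟩)_{x*}` in all
other cases, where `ε_d` is the scalar described in the four cases below. -/
theorem stmt_3 (k : Type) [Field k] (m : ℕ) [NeZero m] (hm : 2 ≤ m)
    (q : ZMod m → k) (hq : ∀ i, q i ≠ 0)
    (d : ℕ) (hd0 : 0 < d) (hd1 : (∏ i : ZMod m, q i) ^ d = 1)
    (hdmin : ∀ e : ℕ, 0 < e → e < d → (∏ i : ZMod m, q i) ^ e ≠ 1) :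
    ((Even m ∨ ringChar k = 2) →
      Nonempty (ZgrA k m q ≃ₐ[k] AstarP k m
        ((-1 : k) ^ (m * d / 2) *
          ∏ l ∈ Finset.Icc 1 (m - 1), ∏ k' ∈ Finset.Icc 1 (l * d), (qprod k m q k' d)⁻¹))) ∧
    ((Odd m ∧ ringChar k ≠ 2 ∧ d % 4 = 0) →
      Nonempty (ZgrA k m q ≃ₐ[k] AstarP k m
        (∏ l ∈ Finset.Icc 1 (m - 1), ∏ k' ∈ Finset.Icc 1 (l * d), (qprod k m q k' d)⁻¹))) ∧
    ((Odd m ∧ ringChar k ≠ 2 ∧ d % 4 = 2) →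
      Nonempty (ZgrA k m q ≃ₐ[k] AstarP k (2 * m)
        (∏ l ∈ Finset.Icc 1 (2 * m - 1), ∏ k' ∈ Finset.Icc 1 (l * d / 2),
          (qprod k m q k' (d / 2))⁻¹))) ∧
    ((Odd m ∧ ringChar k ≠ 2 ∧ Odd d) →
      Nonempty (ZgrA k m q ≃ₐ[k] AstarP k m
        (∏ l ∈ Finset.Icc 1 (m - 1), ∏ k' ∈ Finset.Icc 1 (2 * l * d),
          (qprod k m q k' (2 * d))⁻¹))) := by
  have hdvd (e : ℕ) : (∏ i, q i)⁻¹ ^ e = 1 ↔ d ∣ e := by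
    rw [inv_pow, inv_eq_one, ← orderOf_dvd_iff_pow_eq_one,
      (orderOf_eq_iff hd0).2 ⟨hd1, fun e he he0 => hdmin e he0 he⟩]
  have hhol := KoszulDual.hol_eq q
  have hodd (h : Odd m) (u : ℕ) : KoszulDual.hol q ^ u = (-1) ^ u * (∏ i, q i)⁻¹ ^ u := by
    rw [hhol, h.neg_one_pow, mul_pow]
  have htwo (h : Odd m) (u : ℕ) (hu : KoszulDual.hol q ^ u = 1) : d ∣ 2 * u := by
    rw [← hdvd, mul_comm, pow_mul]
    have h1 := congrArg (· ^ 2) hu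
    simpa [hodd h, mul_pow, ← pow_mul, mul_comm u 2] using h1
  have hsign (h : Odd m) (u : ℕ) : (-1 : k) ^ (m * u) = (-1) ^ u := by
    rw [pow_mul, h.neg_one_pow]
  refine ⟨fun h => ?_, fun ⟨h, hc, hd⟩ => ?_, fun ⟨h, hc, hd⟩ => ?_, fun ⟨h, hc, hd⟩ => ?_⟩
  · have hm1 : (-1 : k) ^ m = 1 := by
      rcases h with h | h
      · exact h.neg_one_pow
      · have := ringChar.of_eq h
        rw [CharTwo.neg_eq, one_pow]
    rw [hm1, one_mul] at hhol
    refine KoszulDual.nonempty_algEquiv hq (D := d) (c := 1) hd0 one_pos (mul_one m).symm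
      (by rw [hhol, hdvd]) (by rw [mul_comm, pow_mul, hm1, one_pow]) (fun u t hu ht => ?_)
      (mul_ne_zero (pow_ne_zero _ (neg_ne_zero.2 one_ne_zero))
        (KoszulDual.prod_inv_qprod_ne_zero hq _ _ _))
    rw [pow_mul, hm1, one_pow] at ht
    rw [hhol, hdvd] at hu ht
    exact ⟨ht, by rwa [mul_one]⟩
  · have hdiv (u : ℕ) (hu : KoszulDual.hol q ^ u = 1) : d ∣ u := by
      have hu2 : Even u := by
        rw [Nat.even_iff]
        obtain ⟨v, hv⟩ := htwo h u hu
        obtain ⟨e, he⟩ := Nat.dvd_of_mod_eq_zero hd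
        rw [he, mul_assoc] at hv
        omega
      rw [hodd h, hu2.neg_one_pow, one_mul, hdvd] at hu
      exact hu
    have hd2 : Even d := by rw [Nat.even_iff]; omega
    refine KoszulDual.nonempty_algEquiv hq (D := d) (c := 1) hd0 one_pos (mul_one m).symm
      (by rw [hodd h, hd2.neg_one_pow, one_mul, hdvd]) (hd2.mul_right m).neg_one_pow
      (fun u t hu ht => ?_) (KoszulDual.prod_inv_qprod_ne_zero hq _ _ _)
    have hu' := hdiv u hu
    rw [hsign h, (hd2.trans_dvd hu').neg_one_pow] at ht
    exact ⟨hdiv t ht, by rwa [mul_one]⟩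
  · obtain ⟨e, rfl⟩ : 2 ∣ d := by omega
    have he : Odd e := by rw [Nat.odd_iff]; omega
    rw [Nat.mul_div_cancel_left e two_pos]
    have hdiv (u : ℕ) : KoszulDual.hol q ^ u = 1 → e ∣ u := fun hu =>
      Nat.dvd_of_mul_dvd_mul_left two_pos (htwo h u hu)
    have hhole : KoszulDual.hol q ^ e = 1 := by
      have h1 : (∏ i, q i)⁻¹ ^ e ≠ 1 := fun h1 => by
        have := Nat.le_of_dvd he.pos ((hdvd e).1 h1)
        have := he.pos
        omega
      have h2 : (∏ i, q i)⁻¹ ^ e * (∏ i, q i)⁻¹ ^ e = 1 := by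
        rw [← pow_add, hdvd, two_mul]
      rw [hodd h, he.neg_one_pow, (mul_self_eq_one_iff.1 h2).resolve_left h1]
      simp
    refine KoszulDual.nonempty_algEquiv hq (D := e) (c := 2) he.pos two_pos (mul_comm 2 m) hhole
      (((even_two_mul m).mul_left e).neg_one_pow) (fun u t hu ht => ?_)
      (KoszulDual.prod_inv_qprod_ne_zero hq _ _ _)
    have ht' : e ∣ t := by
      refine he.coprime_two_right.dvd_of_dvd_mul_right (hdiv (t * 2) ?_)
      rw [pow_mul, ht, ← pow_mul]
      exact (even_two.mul_left _).neg_one_pow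
    refine ⟨ht', he.coprime_two_right.mul_dvd_of_dvd_of_dvd (hdiv u hu) (even_iff_two_dvd.1 ?_)⟩
    obtain ⟨v, rfl⟩ := ht'
    rw [pow_mul, hhole, one_pow, hsign h] at ht
    exact KoszulDual.even_of_neg_one_pow_eq_one hc ht.symm
  · have hdiv (u : ℕ) (hu : KoszulDual.hol q ^ u = 1) : 2 * d ∣ u := by
      have h1 : d ∣ u := hd.coprime_two_right.dvd_of_dvd_mul_left (htwo h u hu)
      rw [hodd h, (hdvd u).2 h1, mul_one] at hu
      exact hd.coprime_two_left.mul_dvd_of_dvd_of_dvd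
        (even_iff_two_dvd.1 (KoszulDual.even_of_neg_one_pow_eq_one hc hu)) h1
    have hd2 : Even (2 * d) := even_two_mul d
    refine KoszulDual.nonempty_algEquiv hq (D := 2 * d) (c := 1) (by omega) one_pos
      (mul_one m).symm
      (by rw [hodd h, hd2.neg_one_pow, one_mul, hdvd]; exact dvd_mul_left d 2)
      (hd2.mul_right m).neg_one_pow
      (fun u t hu ht => ?_) (KoszulDual.prod_inv_qprod_ne_zero hq _ _ _)
    have hu' := hdiv u hu
    rw [hsign h, (hd2.trans_dvd hu').neg_one_pow] at ht
    exact ⟨hdiv t ht, by rwa [mul_one]⟩
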